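/- arXiv:2601.03246 — 10 statements merged into one kernel-verified Lean document; each statement's English description precedes it below -/
import Mathlib

section
/- Let D be a principal ideal domain with infinitely many maximal ideals such that for every nonzero prime ideal M' of D the residue ring D/M' is finite, and let M be a fixed nonzero prime ideal of D. Let n ≥ 1 and let 1 ≤ m_1 ≤ m_2 ≤ ... ≤ m_n be natural numbers. Then there exists a polynomial H ∈ Int(M,D) that has exactly n essentially different factorizations into irreducible elements of Int(M,D), and the lengths of these n factorizations are m_1 + 1, m_2 + 1, ..., m_n + 1 (with multiplicity). Equivalently, there are exactly n multisets of associate classes of irreducible elements of Int(M,D) whose product is the associate class of H, and the multiset of their cardinalities is {m_1 + 1, ..., m_n + 1}. -/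
open Polynomial

/-- The ring of integer-valued polynomials on a subset `S` of `D`,
`Int(S,D) = {f ∈ K[x] : f(s) ∈ D for all s ∈ S}`, as a subring of `K[x]`
where `K = FractionRing D`. -/
noncomputable def IntS (D : Type*) [CommRing D] [IsDomain D] (S : Set D) :
    Subring (Polynomial (FractionRing D)) where
  carrier := {f | ∀ s ∈ S,
    f.eval (algebraMap D (FractionRing D) s) ∈ (algebraMap D (FractionRing D)).range}
  zero_mem' := by intro s _; simp
  one_mem' := by intro s _; simp
  add_mem' := by
    intro a b ha hb s hs
    rw [eval_add]
    exact add_mem (ha s hs) (hb s hs)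
  mul_mem' := by
    intro a b ha hb s hs
    rw [eval_mul]
    exact mul_mem (ha s hs) (hb s hs)
  neg_mem' := by
    intro a ha s hs
    rw [eval_neg]
    exact neg_mem (ha s hs)

/-- The set of (essentially different) factorizations of `h` into irreducibles,
encoded as multisets of associate classes of irreducible elements whose product
is the associate class of `h`. -/
def factorizationsOf {R : Type*} [CommMonoid R] (h : R) : Set (Multiset (Associates R)) :=
  {s | (∀ a ∈ s, Irreducible a) ∧ s.prod = Associates.mk h}

theorem finite_setOf_prime_ideal_mem {D : Type*} [CommRing D] [IsDedekindDomain D] {t : D}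
    (ht : t ≠ 0) : {I : Ideal D | I.IsPrime ∧ I ≠ ⊥ ∧ t ∈ I}.Finite := by
  refine ((Ideal.finite_factors (I := Ideal.span {t}) (by simpa using ht)).image
    (fun v => v.asIdeal)).subset ?_
  rintro I ⟨hI, h0, hmem⟩
  exact ⟨⟨I, hI, h0⟩, by simpa [Ideal.dvd_span_singleton] using hmem, rfl⟩

theorem infinite_of_infinite_setOf_isMaximal {D : Type*} [CommRing D]
    (hinf : {I : Ideal D | I.IsMaximal}.Infinite) : Infinite D := by
  by_contra h
  rw [not_infinite_iff_finite] at h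
  have : Finite (Ideal D) := Finite.of_injective (fun I : Ideal D => (I : Set D))
    SetLike.coe_injective
  exact hinf (Set.toFinite _)

theorem finite_setOf_isPrime_card_quotient_le {D : Type*} [CommRing D] [IsDedekindDomain D]
    [Infinite D] (hfin : ∀ I : Ideal D, I ≠ ⊥ → I.IsPrime → Finite (D ⧸ I)) (B : ℕ) :
    {I : Ideal D | I.IsPrime ∧ I ≠ ⊥ ∧ Nat.card (D ⧸ I) ≤ B}.Finite := by
  set f : D[X] := ∏ q ∈ Finset.Icc 2 B, (X ^ q - X) with hf
  have hf0 : f ≠ 0 := Finset.prod_ne_zero_iff.2 fun q hq =>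
    (monic_X_pow_sub (by
      rw [degree_X]; exact_mod_cast (Finset.mem_Icc.1 hq).1)).ne_zero
  obtain ⟨a, ha⟩ : ∃ a, f.eval a ≠ 0 := by
    by_contra! h
    exact hf0 (Polynomial.funext fun a => by rw [h a, eval_zero])
  refine (finite_setOf_prime_ideal_mem ha).subset ?_
  rintro I ⟨hI, h0, hB⟩
  refine ⟨hI, h0, ?_⟩
  have := hfin I h0 hI
  have := Fintype.ofFinite (D ⧸ I)
  have hmax : I.IsMaximal := hI.isMaximal h0
  let := Ideal.Quotient.field I
  rw [Nat.card_eq_fintype_card] at hB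
  have hmem : Fintype.card (D ⧸ I) ∈ Finset.Icc 2 B :=
    Finset.mem_Icc.2 ⟨Fintype.one_lt_card, hB⟩
  rw [hf, eval_prod]
  refine Ideal.mem_of_dvd _ (Finset.dvd_prod_of_mem _ hmem) ?_
  rw [← Ideal.Quotient.eq_zero_iff_mem]
  simp [FiniteField.pow_card]

theorem exists_coprime_primes_card_quotient_gt {D : Type*} [CommRing D] [IsDomain D]
    [IsPrincipalIdealRing D] (hinf : {I : Ideal D | I.IsMaximal}.Infinite)
    (hfin : ∀ I : Ideal D, I ≠ ⊥ → I.IsPrime → Finite (D ⧸ I))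
    (M : Ideal D) (hM : M.IsPrime) (hM0 : M ≠ ⊥) (B : ℕ) :
    ∃ p l : D, Prime p ∧ Prime l ∧ IsCoprime p l ∧ M ⊔ Ideal.span {p} = ⊤ ∧
      B < Nat.card (D ⧸ Ideal.span {p}) := by
  have := infinite_of_infinite_setOf_isMaximal hinf
  have key : ∀ {I : Ideal D}, I.IsMaximal → I ≠ ⊥ → ∃ p, Prime p ∧ I = Ideal.span {p} := by
    intro I hI h0
    obtain ⟨p, rfl⟩ := (IsPrincipalIdealRing.principal I).principal
    refine ⟨p, (Ideal.span_singleton_prime ?_).1 hI.isPrime, rfl⟩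
    rintro rfl
    simp at h0
  have hex : ∀ s : Set (Ideal D), s.Finite → ∃ p, Prime p ∧ (Ideal.span {p}).IsMaximal ∧
      Ideal.span {p} ∉ s := by
    intro s hs
    obtain ⟨I, hI, hIs⟩ := (hinf.sdiff (hs.union (Set.finite_singleton ⊥))).nonempty
    obtain ⟨p, hp, rfl⟩ := key hI fun h => hIs (Or.inr h)
    exact ⟨p, hp, hI, fun h => hIs (Or.inl h)⟩
  obtain ⟨p, hp, hpm, hps⟩ :=
    hex _ ((finite_setOf_isPrime_card_quotient_le hfin B).union (Set.finite_singleton M))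
  obtain ⟨l, hl, hlm, hls⟩ := hex {Ideal.span {p}} (Set.finite_singleton _)
  refine ⟨p, l, hp, hl, ?_, ?_, ?_⟩
  · rw [← Ideal.isCoprime_span_singleton_iff]
    exact Ideal.isCoprime_of_isMaximal fun h => hls h.symm
  · exact (hM.isMaximal hM0).coprime_of_ne hpm fun h => hps (Or.inr h.symm)
  · by_contra! h
    exact hps (Or.inl ⟨hpm.isPrime, by simpa using hp.ne_zero, h⟩)

theorem isPrimitive_of_isCoprime_coeff {R : Type*} [CommRing R] {f : R[X]} {i j : ℕ}
    (h : IsCoprime (f.coeff i) (f.coeff j)) : f.IsPrimitive := fun r hr =>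
  h.isUnit_of_dvd' ((C_dvd_iff_dvd_coeff r f).1 hr i) ((C_dvd_iff_dvd_coeff r f).1 hr j)

theorem isUnit_of_isUnit_reverse {R : Type*} [CommRing R] [IsDomain R] {f : R[X]}
    (h0 : f.coeff 0 ≠ 0) (h : IsUnit f.reverse) : IsUnit f := by
  have hdeg : f.natDegree = 0 := by
    have := natDegree_eq_zero_of_isUnit h
    rwa [reverse_natDegree, natTrailingDegree_eq_zero.2 (Or.inr h0), Nat.sub_zero] at this
  rw [eq_C_of_natDegree_eq_zero hdeg, reverse_C] at h
  rwa [eq_C_of_natDegree_eq_zero hdeg]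

theorem irreducible_of_irreducible_reverse {R : Type*} [CommRing R] [IsDomain R] {f : R[X]}
    (h0 : f.coeff 0 ≠ 0) (h : Irreducible f.reverse) : Irreducible f where
  not_isUnit hu := by
    obtain ⟨r, hr, rfl⟩ := isUnit_iff.1 hu
    rw [reverse_C] at h
    exact h.not_isUnit hu
  isUnit_or_isUnit a b hab := by
    have hc : a.coeff 0 * b.coeff 0 ≠ 0 := by rwa [← mul_coeff_zero, ← hab]
    rw [hab, reverse_mul_of_domain] at h
    exact (h.isUnit_or_isUnit rfl).imp (isUnit_of_isUnit_reverse (left_ne_zero_of_mul hc))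
      (isUnit_of_isUnit_reverse (right_ne_zero_of_mul hc))

/-- Eisenstein's criterion for the reversed polynomial. -/
theorem irreducible_of_reverse_eisenstein {R : Type*} [CommRing R] [IsDomain R] {f : R[X]}
    {P : Ideal R} (hP : P.IsPrime) (h0 : f.coeff 0 ∉ P) (hpos : ∀ i, 0 < i → f.coeff i ∈ P)
    (hdeg : 0 < f.natDegree) (hlead : f.leadingCoeff ∉ P ^ 2)
    (hcop : IsCoprime (f.coeff 0) f.leadingCoeff) : Irreducible f := by
  have hne : f.coeff 0 ≠ 0 := fun h => h0 (h ▸ P.zero_mem)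
  have htd : f.natTrailingDegree = 0 := natTrailingDegree_eq_zero.2 (Or.inr hne)
  have hrd : f.reverse.natDegree = f.natDegree := by rw [reverse_natDegree, htd, Nat.sub_zero]
  have hrl : f.reverse.leadingCoeff = f.coeff 0 := by
    rw [reverse_leadingCoeff, trailingCoeff, htd]
  have hr0 : f.reverse.coeff 0 = f.leadingCoeff := coeff_zero_reverse f
  refine irreducible_of_irreducible_reverse hne
    (irreducible_of_eisenstein_criterion hP (by rwa [hrl]) ?_ ?_ (by rwa [hr0]) ?_)
  · intro k hk
    have hk' : k < f.natDegree := hrd ▸ (coe_lt_degree.1 hk)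
    rw [coeff_reverse, revAt_le hk'.le]
    exact hpos _ (by omega)
  · rwa [← natDegree_pos_iff_degree_pos, hrd]
  · refine isPrimitive_of_isCoprime_coeff (i := f.reverse.natDegree) (j := 0) ?_
    rwa [hr0, coeff_natDegree, hrl]

/-- Every function on a finite field is given by a monic polynomial of any prescribed degree at
least the order of the field. -/
theorem exists_monic_eval_eq {k : Type*} [Field k] [Finite k] (φ : k → k) (N : ℕ) :
    ∃ g : k[X], g.Monic ∧ g.natDegree = Nat.card k + N ∧ ∀ z, g.eval z = φ z := by
  classical
  have := Fintype.ofFinite k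
  have hinj : Set.InjOn (id : k → k) (Finset.univ : Finset k) := Function.injective_id.injOn
  set r := Lagrange.interpolate Finset.univ (id : k → k) φ with hr
  have hq : 1 < Fintype.card k := Fintype.one_lt_card
  have hmon : ((X ^ Fintype.card k - X) * X ^ N : k[X]).Monic :=
    (monic_X_pow_sub (by rw [degree_X]; exact_mod_cast hq)).mul (monic_X_pow N)
  have hdeg : ((X ^ Fintype.card k - X) * X ^ N : k[X]).natDegree = Fintype.card k + N := by
    rw [natDegree_mul (FiniteField.X_pow_card_sub_X_ne_zero k hq) (by simp),
      FiniteField.X_pow_card_sub_X_natDegree_eq k hq, natDegree_X_pow]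
  have hlt : r.degree < ((X ^ Fintype.card k - X) * X ^ N : k[X]).degree := by
    refine (Lagrange.degree_interpolate_lt φ hinj).trans_le ?_
    rw [degree_eq_natDegree hmon.ne_zero, hdeg, Finset.card_univ]
    exact_mod_cast Nat.le_add_right _ _
  refine ⟨_, hmon.add_of_left hlt, ?_, fun z => ?_⟩
  · rw [natDegree_add_eq_left_of_degree_lt hlt, hdeg, Nat.card_eq_fintype_card]
  · have := Lagrange.eval_interpolate_at_node φ hinj (Finset.mem_univ z)
    rw [id, ← hr] at this
    rw [eval_add, this]
    simp [FiniteField.pow_card]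

theorem exists_irreducible_eval_mod {D : Type*} [CommRing D] [IsDomain D]
    [IsPrincipalIdealRing D] {p l : D} (hp : Prime p) (hl : Prime l) (hpl : IsCoprime p l)
    [Finite (D ⧸ Ideal.span {p})] (φ : D ⧸ Ideal.span {p} → D ⧸ Ideal.span {p}) {c : D}
    (hc0 : φ 0 = Ideal.Quotient.mk _ c) (hcl : IsCoprime c l) (hcp : c ∣ p) (N : ℕ) :
    ∃ F : D[X], F.eval 0 = c ∧ (∀ d, Ideal.Quotient.mk (Ideal.span {p}) (F.eval d) =
        φ (Ideal.Quotient.mk _ d)) ∧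
      F.natDegree = Nat.card (D ⧸ Ideal.span {p}) + N ∧ F.IsPrimitive ∧ Irreducible F := by
  have : (Ideal.span {p}).IsMaximal :=
    PrincipalIdealRing.isMaximal_of_irreducible hp.irreducible
  let := Ideal.Quotient.field (Ideal.span {p})
  obtain ⟨g₀, hg₀m, hg₀d, hg₀⟩ := exists_monic_eval_eq φ N
  obtain ⟨g, hg, hgd, hgm⟩ := lifts_and_natDegree_eq_and_monic (f := Ideal.Quotient.mk
    (Ideal.span {p})) (p := g₀) ((mem_lifts _).2
      (map_surjective _ Ideal.Quotient.mk_surjective g₀)) hg₀m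
  have hgdpos : 0 < g.natDegree := by
    rw [hgd, hg₀d]; have := Nat.card_pos (α := D ⧸ Ideal.span {p}); omega
  have hgφ : ∀ d, Ideal.Quotient.mk (Ideal.span {p}) (g.eval d) =
      φ (Ideal.Quotient.mk _ d) := fun d => by
    rw [← hg₀, ← hg, eval_map_apply]
  obtain ⟨a, b, hab⟩ := (hpl.pow_right (n := 2))
  -- `u` is congruent to `1` modulo `p` and to `l` modulo `l ^ 2`
  set u : D := l * (a * p) + b * l ^ 2 with hu
  have hup : u = 1 + p * (a * l - a) := by rw [hu]; linear_combination hab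
  have hul : u = l + l ^ 2 * (b - b * l) := by rw [hu]; linear_combination l * hab
  have hu0 : u ≠ 0 := by
    intro h
    have h1 : l ^ 2 ∣ l := ⟨-(b - b * l), by linear_combination h - hul⟩
    exact hl.not_isUnit (isUnit_of_dvd_one
      ((mul_dvd_mul_iff_left hl.ne_zero).1 (by simpa [sq] using h1)))
  set h : D[X] := C u * (g - C (g.coeff 0)) with hh
  set F : D[X] := h + C c with hF
  have hhd : h.natDegree = g.natDegree := by
    rw [hh, natDegree_C_mul hu0, natDegree_sub_C]
  have hFd : F.natDegree = g.natDegree := by rw [hF, natDegree_add_C, hhd]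
  have hcoeff : ∀ i, 0 < i → F.coeff i = u * g.coeff i := fun i hi => by
    simp [hF, hh, coeff_C, hi.ne']
  have hF0 : F.coeff 0 = c := by simp [hF, hh]
  have hlead : F.leadingCoeff = u := by
    rw [leadingCoeff, hFd, hcoeff _ hgdpos, coeff_natDegree, hgm.leadingCoeff, mul_one]
  have hcu : IsCoprime c u := by
    obtain ⟨e, rfl⟩ := hcp
    exact ⟨-(e * (a * l - a)), 1, by rw [hup]; ring⟩
  have hmeml : ∀ x, x ∈ Ideal.span {l} ↔ l ∣ x := fun x => Ideal.mem_span_singleton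
  refine ⟨F, by rw [← coeff_zero_eq_eval_zero, hF0], fun d => ?_, by rw [hFd, hgd, hg₀d],
    isPrimitive_of_isCoprime_coeff (i := 0) (j := F.natDegree)
      (by rwa [hF0, coeff_natDegree, hlead]),
    irreducible_of_reverse_eisenstein (P := Ideal.span {l})
      ((Ideal.span_singleton_prime hl.ne_zero).2 hl) ?_ (fun i hi => ?_) (by rwa [hFd]) ?_
      (by rwa [hF0, hlead])⟩
  · have hu1 : Ideal.Quotient.mk (Ideal.span {p}) u = 1 := by
      rw [← map_one (Ideal.Quotient.mk (Ideal.span {p})), Ideal.Quotient.eq,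
        Ideal.mem_span_singleton]
      exact ⟨a * l - a, by rw [hup]; ring⟩
    have hg0 : Ideal.Quotient.mk (Ideal.span {p}) (g.coeff 0) = Ideal.Quotient.mk _ c := by
      rw [coeff_zero_eq_eval_zero, hgφ, map_zero, hc0]
    simp [hF, hh, hu1, hg0, hgφ]
  · rw [hF0, hmeml]
    exact fun hd => hl.not_isUnit (hcl.isUnit_of_dvd' hd dvd_rfl)
  · rw [hmeml, hcoeff i hi]
    exact Dvd.dvd.mul_right ⟨a * p + b * l, by rw [hu]; ring⟩ _
  · rw [hlead, Ideal.span_singleton_pow, Ideal.mem_span_singleton]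
    rintro ⟨e, he⟩
    have h1 : l ^ 2 ∣ l := ⟨e - (b - b * l), by linear_combination he - hul⟩
    exact hl.not_isUnit (isUnit_of_dvd_one
      ((mul_dvd_mul_iff_left hl.ne_zero).1 (by simpa [sq] using h1)))

section Products

variable {V K : Type*} [Field K] {Ψ : V → K[X]}

theorem multiset_eq_of_associated_prod (hirr : ∀ v, Irreducible (Ψ v))
    (hassoc : ∀ v w, Associated (Ψ v) (Ψ w) → v = w) {s t : Multiset V}
    (h : Associated (s.map Ψ).prod (t.map Ψ).prod) : s = t := by
  have hinj : Function.Injective fun v => Associates.mk (Ψ v) := fun v w hvw =>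
    hassoc v w (Associates.mk_eq_mk_iff_associated.1 hvw)
  have hrel : Multiset.Rel Associated (s.map Ψ) (t.map Ψ) :=
    UniqueFactorizationMonoid.factors_unique (by simpa using fun v _ => hirr v)
      (by simpa using fun v _ => hirr v) h
  apply Multiset.map_injective hinj
  simpa [Multiset.map_map] using Associates.rel_associated_iff_map_eq_map.1 hrel

theorem exists_subset_of_mul_eq_prod [DecidableEq V] (hirr : ∀ v, Irreducible (Ψ v))
    (h0 : ∀ v, (Ψ v).eval 0 = 1) {U : Finset V} {f g : K[X]} (h : f * g = ∏ v ∈ U, Ψ v) :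
    ∃ T ⊆ U, f = C (f.eval 0) * ∏ v ∈ T, Ψ v ∧ g = C (g.eval 0) * ∏ v ∈ U \ T, Ψ v := by
  obtain ⟨T, T', b, c, hU, hdisj, hbc, hf, hg⟩ := mul_eq_mul_prime_prod (a := 1)
    (fun v _ => (hirr v).prime) (by rw [h, one_mul])
  have hT' : T' = U \ T := by rw [← hU, Finset.union_sdiff_cancel_left hdisj]
  have hconst : ∀ {b : K[X]} {f : K[X]} {T : Finset V}, IsUnit b → f = b * ∏ v ∈ T, Ψ v →
      f = C (f.eval 0) * ∏ v ∈ T, Ψ v := by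
    rintro b f T hb rfl
    obtain ⟨r, -, rfl⟩ := isUnit_iff.1 hb
    simp [eval_prod, h0]
  subst hT'
  exact ⟨T, hU ▸ Finset.subset_union_left, hconst (IsUnit.of_mul_eq_one _ hbc.symm) hf,
    hconst (IsUnit.of_mul_eq_one _ (mul_comm b c ▸ hbc.symm)) hg⟩

end Products

/-- The nonempty members of a family of finite sets that are not a disjoint union of two nonempty
members. -/
def IsIndecomposable {V : Type*} [DecidableEq V] (A : Finset V → Prop) (T : Finset V) : Prop :=
  A T ∧ T.Nonempty ∧ ∀ T₁ ⊆ T, A T₁ → A (T \ T₁) → T₁ = ∅ ∨ T₁ = T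

section IntegerValued

variable {V D : Type*} [DecidableEq V] [CommRing D] [IsDomain D] {S : Set D}
  {Ψ : V → (FractionRing D)[X]}

theorem C_algebraMap_mem_IntS (d : D) :
    C (algebraMap D (FractionRing D) d) ∈ IntS D S := fun s _ => by simp

theorem eval_zero_mem_range (hS : (0 : D) ∈ S) (f : IntS D S) :
    ∃ d, algebraMap D (FractionRing D) d = (f : (FractionRing D)[X]).eval 0 := by
  simpa using f.2 0 hS

theorem associated_of_eq_C_mul {f g : IntS D S} {d : D} (hd : IsUnit d)
    (h : (f : (FractionRing D)[X]) =
      C (algebraMap D (FractionRing D) d) * (g : (FractionRing D)[X])) : Associated f g := by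
  obtain ⟨u, rfl⟩ := hd
  refine Associated.symm ⟨⟨⟨_, C_algebraMap_mem_IntS (u : D)⟩,
    ⟨_, C_algebraMap_mem_IntS ((u⁻¹ : Dˣ) : D)⟩,
    ?_, ?_⟩, ?_⟩ <;> ext1
  · simp [← map_mul]
  · simp [← map_mul]
  · simp [h, mul_comm]

/-- `A` is the family of index sets whose products of the `Ψ v` are integer-valued on `S`. -/
def IntegralProd (S : Set D) (Ψ : V → (FractionRing D)[X]) (T : Finset V) : Prop :=
  ∏ v ∈ T, Ψ v ∈ IntS D S

theorem exists_associated_of_mul_eq (hS : (0 : D) ∈ S) (hirr : ∀ v, Irreducible (Ψ v))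
    (h0 : ∀ v, (Ψ v).eval 0 = 1) {U : Finset V} (hU : IntegralProd S Ψ U) {f g : IntS D S}
    (h : f * g = ⟨_, hU⟩) :
    ∃ T ⊆ U, ∃ (h₁ : IntegralProd S Ψ T) (h₂ : IntegralProd S Ψ (U \ T)),
      Associated f ⟨_, h₁⟩ ∧ Associated g ⟨_, h₂⟩ := by
  have h' : (f : (FractionRing D)[X]) * g = ∏ v ∈ U, Ψ v := congrArg Subtype.val h
  obtain ⟨T, hT, hf, hg⟩ := exists_subset_of_mul_eq_prod hirr h0 h'
  obtain ⟨a, ha⟩ := eval_zero_mem_range hS f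
  obtain ⟨b, hb⟩ := eval_zero_mem_range hS g
  have hab : a * b = 1 := by
    apply IsFractionRing.injective D (FractionRing D)
    rw [map_mul, ha, hb, ← eval_mul, h', eval_prod, map_one]
    simp [h0]
  have hba : b * a = 1 := by rw [mul_comm, hab]
  rw [← ha] at hf
  rw [← hb] at hg
  have hmem : ∀ {a b : D} {f : IntS D S} {T : Finset V}, b * a = 1 →
      (f : (FractionRing D)[X]) = C (algebraMap D _ a) * ∏ v ∈ T, Ψ v → IntegralProd S Ψ T := by
    intro a b f T hba hf
    have : ∏ v ∈ T, Ψ v = C (algebraMap D (FractionRing D) b) * (f : (FractionRing D)[X]) := by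
      rw [hf, ← mul_assoc, ← C_mul, ← map_mul, hba, map_one, C_1, one_mul]
    rw [IntegralProd, this]
    exact mul_mem (C_algebraMap_mem_IntS b) f.2
  exact ⟨T, hT, hmem hba hf, hmem hab hg,
    associated_of_eq_C_mul (IsUnit.of_mul_eq_one _ hab) hf,
    associated_of_eq_C_mul (IsUnit.of_mul_eq_one _ hba) hg⟩

theorem isUnit_prod_iff (hirr : ∀ v, Irreducible (Ψ v)) {T : Finset V}
    (hT : IntegralProd S Ψ T) : IsUnit (⟨_, hT⟩ : IntS D S) ↔ T = ∅ := by
  refine ⟨fun h => ?_, ?_⟩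
  · by_contra hne
    obtain ⟨v, hv⟩ := Finset.nonempty_iff_ne_empty.2 hne
    have : IsUnit (∏ v ∈ T, Ψ v) := h.map (IntS D S).subtype
    exact (hirr v).not_isUnit (isUnit_of_dvd_unit (Finset.dvd_prod_of_mem Ψ hv) this)
  · rintro rfl
    convert isUnit_one
    ext1
    simp

theorem prod_mul_prod_sdiff {T U : Finset V} (h : T ⊆ U) (hU : IntegralProd S Ψ U)
    (hT : IntegralProd S Ψ T) (hT' : IntegralProd S Ψ (U \ T)) :
    (⟨_, hT⟩ * ⟨_, hT'⟩ : IntS D S) = ⟨_, hU⟩ := by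
  ext1
  exact (mul_comm _ _).trans (Finset.prod_sdiff h)

theorem irreducible_prod_iff (hS : (0 : D) ∈ S) (hirr : ∀ v, Irreducible (Ψ v))
    (h0 : ∀ v, (Ψ v).eval 0 = 1) {T : Finset V} (hT : IntegralProd S Ψ T) :
    Irreducible (⟨_, hT⟩ : IntS D S) ↔ IsIndecomposable (IntegralProd S Ψ) T := by
  refine ⟨fun h => ⟨hT, ?_, fun T₁ hT₁ hA hA' => ?_⟩, fun h => ⟨?_, fun f g hfg => ?_⟩⟩
  · rw [Finset.nonempty_iff_ne_empty]
    exact fun he => h.not_isUnit ((isUnit_prod_iff hirr hT).2 he)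
  · refine (h.isUnit_or_isUnit (prod_mul_prod_sdiff hT₁ hT hA hA').symm).imp
      (isUnit_prod_iff hirr hA).1 fun hu => hT₁.antisymm ?_
    rw [← Finset.sdiff_eq_empty_iff_subset, (isUnit_prod_iff hirr hA').1 hu]
  · rw [isUnit_prod_iff hirr hT]
    exact h.2.1.ne_empty
  · obtain ⟨T₁, hT₁, hA, hA', hf, hg⟩ := exists_associated_of_mul_eq hS hirr h0 hT hfg.symm
    rw [hf.isUnit_iff, hg.isUnit_iff, isUnit_prod_iff hirr, isUnit_prod_iff hirr]
    exact (h.2.2 T₁ hT₁ hA hA').imp_right fun h => by rw [h, Finset.sdiff_self]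

open Classical in
/-- The associate class in `Int(S, D)` of the product of the `Ψ v` over `T`, when that product is
integer-valued on `S`. -/
noncomputable def prodClass (S : Set D) (Ψ : V → (FractionRing D)[X]) (T : Finset V) :
    Associates (IntS D S) :=
  if h : IntegralProd S Ψ T then Associates.mk ⟨_, h⟩ else 1

omit [DecidableEq V] in
theorem prodClass_eq {T : Finset V} (hT : IntegralProd S Ψ T) :
    prodClass S Ψ T = Associates.mk ⟨_, hT⟩ := dif_pos hT

theorem exists_prodClass_eq_of_irreducible_of_dvd (hS : (0 : D) ∈ S)
    (hirr : ∀ v, Irreducible (Ψ v)) (h0 : ∀ v, (Ψ v).eval 0 = 1) {U : Finset V}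
    (hU : IntegralProd S Ψ U) {a : Associates (IntS D S)} (ha : Irreducible a)
    (hdvd : a ∣ Associates.mk ⟨_, hU⟩) :
    ∃ T, IsIndecomposable (IntegralProd S Ψ) T ∧ prodClass S Ψ T = a := by
  induction a using Quotient.inductionOn with | _ f
  replace ha : Irreducible f := Associates.irreducible_mk.1 ha
  obtain ⟨g, hg⟩ := Associates.mk_dvd_mk.1 hdvd
  obtain ⟨T, -, hA, -, hf, -⟩ := exists_associated_of_mul_eq hS hirr h0 hU hg.symm
  refine ⟨T, (irreducible_prod_iff hS hirr h0 hA).1 (hf.irreducible_iff.1 ha), ?_⟩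
  rw [prodClass_eq hA]
  exact (Associates.mk_eq_mk_iff_associated.2 hf).symm

omit [DecidableEq V] in
theorem prod_map_prodClass {w : Multiset (Finset V)} (hw : ∀ T ∈ w, IntegralProd S Ψ T) :
    ∃ h : ((w.map Finset.val).sum.map Ψ).prod ∈ IntS D S,
      (w.map (prodClass S Ψ)).prod = Associates.mk ⟨_, h⟩ := by
  induction w using Multiset.induction_on with
  | empty => exact ⟨by simp [one_mem], by simp [← Associates.mk_one]; rfl⟩
  | cons T w ih =>
    obtain ⟨h, hp⟩ := ih fun T hT => hw T (Multiset.mem_cons_of_mem hT)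
    have hT := hw T (Multiset.mem_cons_self T w)
    have heq : (((T ::ₘ w).map Finset.val).sum.map Ψ).prod =
        (∏ v ∈ T, Ψ v) * ((w.map Finset.val).sum.map Ψ).prod := by
      rw [Multiset.map_cons, Multiset.sum_cons, Multiset.map_add, Multiset.prod_add,
        Finset.prod_map_val]
    refine ⟨heq ▸ mul_mem hT h, ?_⟩
    rw [Multiset.map_cons, Multiset.prod_cons, hp, prodClass_eq hT, Associates.mk_mul_mk]
    congr 1
    ext1
    exact heq.symm

theorem associated_of_associated_mk {f g : (FractionRing D)[X]} {hf : f ∈ IntS D S}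
    {hg : g ∈ IntS D S} (h : Associated (⟨f, hf⟩ : IntS D S) ⟨g, hg⟩) : Associated f g :=
  h.map (IntS D S).subtype

omit [DecidableEq V] in
theorem prodClass_injOn (hirr : ∀ v, Irreducible (Ψ v))
    (hassoc : ∀ v w, Associated (Ψ v) (Ψ w) → v = w) :
    Set.InjOn (prodClass S Ψ) {T | IntegralProd S Ψ T} := by
  intro T hT T' hT' h
  rw [prodClass_eq hT, prodClass_eq hT', Associates.mk_eq_mk_iff_associated] at h
  replace h := associated_of_associated_mk h
  rw [← Finset.prod_map_val, ← Finset.prod_map_val] at h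
  exact Finset.val_injective (multiset_eq_of_associated_prod hirr hassoc h)

/-- Factorizations of a product of the `Ψ v` correspond to partitions of its index set into
indecomposable members of the family of integral index sets. -/
theorem mem_factorizationsOf_prod_iff (hS : (0 : D) ∈ S) (hirr : ∀ v, Irreducible (Ψ v))
    (hassoc : ∀ v w, Associated (Ψ v) (Ψ w) → v = w) (h0 : ∀ v, (Ψ v).eval 0 = 1)
    {U : Finset V} (hU : IntegralProd S Ψ U) (s : Multiset (Associates (IntS D S))) :
    s ∈ factorizationsOf (⟨_, hU⟩ : IntS D S) ↔ ∃ w : Multiset (Finset V),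
      (∀ T ∈ w, IsIndecomposable (IntegralProd S Ψ) T) ∧ (w.map Finset.val).sum = U.val ∧
      s = w.map (prodClass S Ψ) := by
  constructor
  · rintro ⟨hs, hprod⟩
    have hlift : ∀ t : Multiset (Associates (IntS D S)),
        (∀ a ∈ t, ∃ T, IsIndecomposable (IntegralProd S Ψ) T ∧ prodClass S Ψ T = a) →
        ∃ w : Multiset (Finset V), (∀ T ∈ w, IsIndecomposable (IntegralProd S Ψ) T) ∧
          t = w.map (prodClass S Ψ) := by
      intro t
      induction t using Multiset.induction_on with
      | empty => exact fun _ => ⟨0, by simp⟩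
      | cons a t ih =>
        intro h
        obtain ⟨w, hw, rfl⟩ := ih fun b hb => h b (Multiset.mem_cons_of_mem hb)
        obtain ⟨T, hT, rfl⟩ := h a (Multiset.mem_cons_self _ _)
        exact ⟨T ::ₘ w, by simpa using ⟨hT, hw⟩, by simp⟩
    obtain ⟨w, hw, rfl⟩ := hlift s fun a ha => exists_prodClass_eq_of_irreducible_of_dvd hS hirr
      h0 hU (hs a ha) (hprod ▸ Multiset.dvd_prod ha)
    refine ⟨w, hw, ?_, rfl⟩
    obtain ⟨h, hp⟩ := prod_map_prodClass fun T hT => (hw T hT).1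
    rw [hp, Associates.mk_eq_mk_iff_associated] at hprod
    replace hprod := associated_of_associated_mk hprod
    rw [← Finset.prod_map_val] at hprod
    exact multiset_eq_of_associated_prod hirr hassoc hprod
  · rintro ⟨w, hw, hsum, rfl⟩
    refine ⟨fun a ha => ?_, ?_⟩
    · obtain ⟨T, hT, rfl⟩ := Multiset.mem_map.1 ha
      rw [prodClass_eq (hw T hT).1, Associates.irreducible_mk]
      exact (irreducible_prod_iff hS hirr h0 _).2 (hw T hT)
    · obtain ⟨h, hp⟩ := prod_map_prodClass fun T hT => (hw T hT).1
      rw [hp]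
      congr 2
      rw [hsum, Finset.prod_map_val]

omit [DecidableEq V] in
theorem map_prodClass_injOn (hirr : ∀ v, Irreducible (Ψ v))
    (hassoc : ∀ v w, Associated (Ψ v) (Ψ w) → v = w) {w w' : Multiset (Finset V)}
    (hw : ∀ T ∈ w, IntegralProd S Ψ T) (hw' : ∀ T ∈ w', IntegralProd S Ψ T)
    (h : w.map (prodClass S Ψ) = w'.map (prodClass S Ψ)) : w = w' := by
  have hleft := (prodClass_injOn (S := S) hirr hassoc).leftInvOn_invFunOn
  have hback : ∀ w : Multiset (Finset V), (∀ T ∈ w, IntegralProd S Ψ T) →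
      (w.map (prodClass S Ψ)).map
        (Function.invFunOn (prodClass S Ψ) {T | IntegralProd S Ψ T}) = w := by
    intro w hw
    rw [Multiset.map_map]
    exact (Multiset.map_congr rfl fun T hT => hleft (hw T hT)).trans (Multiset.map_id' w)
  rw [← hback w hw, h, hback w' hw']

end IntegerValued

section Partitions

variable {V ι : Type*} [Fintype V] [DecidableEq V] {A : Finset V → Prop} {o : V}
  {B : ι → Finset V}

theorem isIndecomposable_iff (hA : ∀ T, A T ↔ o ∉ T ∨ ∃ k, Tᶜ ⊆ B k)
    (hdisj : ∀ j k, B j ⊆ B k → j = k) (ho : ∀ k, o ∉ B k) (T : Finset V) :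
    IsIndecomposable A T ↔ (∃ v, v ≠ o ∧ T = {v}) ∨ ∃ k, T = (B k)ᶜ := by
  constructor
  · rintro ⟨hT, ⟨v, hv⟩, hmin⟩
    by_cases hoT : o ∈ T
    · obtain ⟨k, hk⟩ := ((hA T).1 hT).resolve_left (not_not_intro hoT)
      have hkT : (B k)ᶜ ⊆ T := compl_le_iff_compl_le.1 hk
      have hmem : o ∈ (B k)ᶜ := Finset.mem_compl.2 (ho k)
      refine Or.inr ⟨k, ((hmin _ hkT ((hA _).2 (Or.inr ⟨k, by rw [compl_compl]⟩))
        ((hA _).2 (Or.inl fun h => (Finset.mem_sdiff.1 h).2 hmem))).resolve_left ?_).symm⟩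
      exact Finset.ne_empty_of_mem hmem
    · have hvo : v ≠ o := fun h => hoT (h ▸ hv)
      exact Or.inl ⟨v, hvo, ((hmin {v} (Finset.singleton_subset_iff.2 hv)
        ((hA _).2 (Or.inl (by simpa using hvo.symm)))
        ((hA _).2 (Or.inl fun h => hoT (Finset.mem_sdiff.1 h).1))).resolve_left
          (Finset.singleton_ne_empty v)).symm⟩
  · rintro (⟨v, hv, rfl⟩ | ⟨k, rfl⟩)
    · exact ⟨(hA _).2 (Or.inl (by simpa using hv.symm)), Finset.singleton_nonempty v,
        fun T₁ hT₁ _ _ => Finset.subset_singleton_iff.1 hT₁⟩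
    · refine ⟨(hA _).2 (Or.inr ⟨k, by rw [compl_compl]⟩), ⟨o, Finset.mem_compl.2 (ho k)⟩, ?_⟩
      have key : ∀ T₁ ⊆ (B k)ᶜ, A T₁ → o ∈ T₁ → T₁ = (B k)ᶜ := by
        intro T₁ hT₁ h₁ hoT
        obtain ⟨j, hj⟩ := ((hA _).1 h₁).resolve_left (not_not_intro hoT)
        obtain rfl : k = j := hdisj k j ((Finset.subset_compl_comm.1 hT₁).trans hj)
        exact hT₁.antisymm (compl_le_iff_compl_le.1 hj)
      intro T₁ hT₁ h₁ h₂
      by_cases hoT : o ∈ T₁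
      · exact Or.inr (key T₁ hT₁ h₁ hoT)
      · have := key _ Finset.sdiff_subset h₂
          (Finset.mem_sdiff.2 ⟨Finset.mem_compl.2 (ho k), hoT⟩)
        rw [Finset.sdiff_eq_self_iff_disjoint] at this
        exact Or.inl ((Finset.disjoint_self_iff_empty _).1 (this.mono_left hT₁))

/-- The partition consisting of the complement of `s` and of the singletons of elements of `s`. -/
def complSingletons (s : Finset V) : Multiset (Finset V) :=
  sᶜ ::ₘ s.val.map fun v => {v}

theorem sum_complSingletons (s : Finset V) :
    ((complSingletons s).map Finset.val).sum = Finset.univ.val := by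
  rw [complSingletons, Multiset.map_cons, Multiset.sum_cons, Multiset.map_map,
    Finset.compl_eq_univ_sdiff, Finset.sdiff_val]
  have : (s.val.map (Finset.val ∘ fun v => {v})).sum = s.val :=
    Multiset.sum_map_singleton s.val
  rw [this, tsub_add_cancel_of_le (Finset.val_le_iff.2 (Finset.subset_univ s))]

theorem partition_iff (hA : ∀ T, A T ↔ o ∉ T ∨ ∃ k, Tᶜ ⊆ B k)
    (hdisj : ∀ j k, B j ⊆ B k → j = k) (ho : ∀ k, o ∉ B k) (w : Multiset (Finset V)) :
    ((∀ T ∈ w, IsIndecomposable A T) ∧ (w.map Finset.val).sum = Finset.univ.val) ↔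
      ∃ k, w = complSingletons (B k) := by
  have hind := isIndecomposable_iff hA hdisj ho
  constructor
  · rintro ⟨hw, hsum⟩
    obtain ⟨T, hT, hoT⟩ : ∃ T ∈ w, o ∈ T := by
      have : o ∈ (w.map Finset.val).sum := hsum ▸ Finset.mem_univ o
      obtain ⟨_, hs, ho'⟩ := Multiset.mem_join.1 this
      obtain ⟨T, hT, rfl⟩ := Multiset.mem_map.1 hs
      exact ⟨T, hT, ho'⟩
    obtain ⟨w, rfl⟩ := Multiset.exists_cons_of_mem hT
    obtain ⟨k, rfl⟩ := ((hind T).1 (hw T hT)).resolve_left (by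
      rintro ⟨v, hv, rfl⟩
      exact hv (Finset.mem_singleton.1 hoT).symm)
    have hrest : (w.map Finset.val).sum = (B k).val := by
      have h := sum_complSingletons (B k)
      rw [← hsum, complSingletons, Multiset.map_cons, Multiset.map_cons, Multiset.sum_cons,
        Multiset.sum_cons, Multiset.map_map] at h
      rw [← add_left_cancel h]
      exact Multiset.sum_map_singleton (B k).val
    have hsing : ∀ u : Multiset (Finset V), (∀ T ∈ u, ∃ v, T = {v}) →
        ∃ t : Multiset V, u = t.map fun v => {v} := by
      intro u
      induction u using Multiset.induction_on with
      | empty => exact fun _ => ⟨0, rfl⟩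
      | cons T u ih =>
        intro h
        obtain ⟨t, rfl⟩ := ih fun T' hT' => h T' (Multiset.mem_cons_of_mem hT')
        obtain ⟨v, rfl⟩ := h T (Multiset.mem_cons_self _ _)
        exact ⟨v ::ₘ t, by simp⟩
    obtain ⟨t, rfl⟩ := hsing w fun T hT' => by
      rcases (hind T).1 (hw T (Multiset.mem_cons_of_mem hT')) with ⟨v, -, rfl⟩ | ⟨j, rfl⟩
      · exact ⟨v, rfl⟩
      · have : o ∈ (B k).val := hrest ▸ Multiset.mem_join.2
          ⟨_, Multiset.mem_map_of_mem _ hT', Finset.mem_compl.2 (ho j)⟩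
        exact absurd this (ho k)
    refine ⟨k, ?_⟩
    rw [Multiset.map_map] at hrest
    have : (t.map (Finset.val ∘ fun v => {v})).sum = t := Multiset.sum_map_singleton t
    rw [complSingletons, ← hrest, this]
  · rintro ⟨k, rfl⟩
    refine ⟨fun T hT => (hind T).2 ?_, sum_complSingletons _⟩
    rcases Multiset.mem_cons.1 hT with rfl | hT
    · exact Or.inr ⟨k, rfl⟩
    · obtain ⟨v, hv, rfl⟩ := Multiset.mem_map.1 hT
      exact Or.inl ⟨v, fun h => ho k (h ▸ hv), rfl⟩

theorem complSingletons_inj (ho : ∀ k, o ∉ B k) {j k : ι}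
    (h : complSingletons (B j) = complSingletons (B k)) : B j = B k := by
  have : (B j)ᶜ ∈ complSingletons (B k) := h ▸ Multiset.mem_cons_self _ _
  rcases Multiset.mem_cons.1 this with h | h
  · exact compl_injective h
  · obtain ⟨v, hv, hvj⟩ := Multiset.mem_map.1 h
    have : o ∈ (B j)ᶜ := Finset.mem_compl.2 (ho j)
    rw [← hvj, Finset.mem_singleton] at this
    exact absurd (this ▸ hv) (ho k)

end Partitions

open Classical in
/-- Zero sets indexed by `Option E` such that a set of indices containing `none` covers everything
if and only if all missing indices lie in a single fibre of `π`. -/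
theorem exists_covering_sets {E ι k : Type*} [Finite E] [Nonempty ι] [Finite k] [AddGroup k]
    (π : E → ι) (hcard : Nat.card (E × E) < Nat.card k) :
    ∃ Z : Option E → Set k, 0 ∈ Z none ∧ (∀ v, 0 ∉ Z (some v)) ∧
      ∀ T : Finset (Option E), none ∈ T →
        ((∀ z, ∃ v ∈ T, z ∈ Z v) ↔ ∃ i, ∀ v, some v ∉ T → π v = i) := by
  have := Fintype.ofFinite E
  have := Fintype.ofFinite k
  obtain ⟨f⟩ : Nonempty (Option (E × E) ↪ k) := by
    rw [Function.Embedding.nonempty_iff_card_le, Fintype.card_option]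
    rw [Nat.card_eq_fintype_card, Nat.card_eq_fintype_card] at hcard
    exact hcard
  set r : E × E → k := fun x => f (some x) - f none with hr
  have hinj : Function.Injective r := fun x y h =>
    Option.some_injective _ (f.injective (sub_left_injective h))
  have hr0 : ∀ x, r x ≠ 0 := fun x h => by simp [hr, sub_eq_zero] at h
  refine ⟨fun v => v.elim {z | ∀ x : E × E, π x.1 ≠ π x.2 → z ≠ r x}
    fun v => {z | ∃ x : E × E, π x.1 ≠ π x.2 ∧ z = r x ∧ (v = x.1 ∨ v = x.2)},
    fun x _ => (hr0 x).symm, fun v ⟨x, _, hx, _⟩ => hr0 x hx.symm, fun T hT => ⟨fun h => ?_, ?_⟩⟩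
  · by_cases hall : ∀ v, some v ∈ T
    · exact ⟨Classical.arbitrary ι, fun v hv => absurd (hall v) hv⟩
    · push Not at hall
      obtain ⟨a, ha⟩ := hall
      refine ⟨π a, fun b hb => ?_⟩
      by_contra hab
      obtain ⟨_ | v, hv, hz⟩ := h (r (a, b))
      · exact hz (a, b) (Ne.symm hab) rfl
      · obtain ⟨x, -, hx, hvx⟩ := hz
        obtain rfl := hinj hx
        rcases hvx with rfl | rfl
        · exact ha hv
        · exact hb hv
  · rintro ⟨i, hi⟩ z
    by_cases hz : ∃ x : E × E, π x.1 ≠ π x.2 ∧ z = r x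
    · obtain ⟨x, hx, rfl⟩ := hz
      by_cases h1 : some x.1 ∈ T
      · exact ⟨_, h1, x, hx, rfl, Or.inl rfl⟩
      · refine ⟨some x.2, ?_, x, hx, rfl, Or.inr rfl⟩
        by_contra h2
        exact hx ((hi _ h1).trans (hi _ h2).symm)
    · push Not at hz
      exact ⟨none, hT, hz⟩

section Assembly

variable {V D : Type*} [CommRing D] [IsDomain D]

theorem integralProd_iff_dvd {S : Set D} {F : V → D[X]} {c : V → D} (hc : ∀ v, c v ≠ 0)
    (T : Finset V) :
    IntegralProd S (fun v => C (algebraMap D (FractionRing D) (c v))⁻¹ *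
        (F v).map (algebraMap D (FractionRing D))) T ↔
      ∀ s ∈ S, ∏ v ∈ T, c v ∣ ∏ v ∈ T, (F v).eval s := by
  refine forall₂_congr fun s _ => ?_
  have hne : algebraMap D (FractionRing D) (∏ v ∈ T, c v) ≠ 0 := by
    rw [Ne, IsFractionRing.to_map_eq_zero_iff]
    exact Finset.prod_ne_zero_iff.2 fun v _ => hc v
  have heval : (∏ v ∈ T, C (algebraMap D (FractionRing D) (c v))⁻¹ *
      (F v).map (algebraMap D (FractionRing D))).eval (algebraMap D (FractionRing D) s) =
      (algebraMap D (FractionRing D) (∏ v ∈ T, c v))⁻¹ *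
        algebraMap D (FractionRing D) (∏ v ∈ T, (F v).eval s) := by
    simp only [eval_prod, eval_mul, eval_C, eval_map_algebraMap, Finset.prod_mul_distrib,
      Finset.prod_inv_distrib, map_prod, aeval_algebraMap_apply, coe_aeval_eq_eval]
  rw [heval]
  constructor
  · rintro ⟨d, hd⟩
    refine ⟨d, IsFractionRing.injective D (FractionRing D) ?_⟩
    rw [map_mul, hd, mul_inv_cancel_left₀ hne]
  · rintro ⟨d, hd⟩
    exact ⟨d, by rw [hd, map_mul, inv_mul_cancel_left₀ hne]⟩

theorem irreducible_C_mul_map [IsPrincipalIdealRing D] {F : D[X]} (hprim : F.IsPrimitive)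
    (hF : Irreducible F) {c : D} (hc : c ≠ 0) :
    Irreducible (C (algebraMap D (FractionRing D) c)⁻¹ *
      F.map (algebraMap D (FractionRing D))) := by
  have hu : IsUnit (C (algebraMap D (FractionRing D) c)⁻¹) := by
    rw [isUnit_C, isUnit_iff_ne_zero, Ne, inv_eq_zero, IsFractionRing.to_map_eq_zero_iff]
    exact hc
  let : NormalizedGCDMonoid D := Nonempty.some inferInstance
  rw [irreducible_isUnit_mul hu]
  exact (hprim.irreducible_iff_irreducible_map_fraction_map).1 hF

theorem natDegree_C_mul_map {F : D[X]} {c : D} (hc : c ≠ 0) :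
    (C (algebraMap D (FractionRing D) c)⁻¹ *
      F.map (algebraMap D (FractionRing D))).natDegree = F.natDegree := by
  rw [natDegree_C_mul, natDegree_map_eq_of_injective (IsFractionRing.injective D _)]
  rw [Ne, inv_eq_zero, IsFractionRing.to_map_eq_zero_iff]
  exact hc

open Classical in
/-- Irreducible polynomials over the fraction field, with value `1` at `0`, whose products are
integer-valued on `M` exactly when `none` is not involved or all missing indices lie in a single
fibre of `π`. -/
theorem exists_family_integralProd_iff [IsPrincipalIdealRing D]
    (hinf : {I : Ideal D | I.IsMaximal}.Infinite)
    (hfin : ∀ I : Ideal D, I ≠ ⊥ → I.IsPrime → Finite (D ⧸ I))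
    (M : Ideal D) (hM : M.IsPrime) (hM0 : M ≠ ⊥)
    {E ι : Type*} [Finite E] [Nonempty ι] (π : E → ι) :
    ∃ Ψ : Option E → (FractionRing D)[X], (∀ v, Irreducible (Ψ v)) ∧
      (∀ v w, Associated (Ψ v) (Ψ w) → v = w) ∧ (∀ v, (Ψ v).eval 0 = 1) ∧
      ∀ T, IntegralProd (M : Set D) Ψ T ↔ none ∉ T ∨ ∃ i, ∀ v, some v ∉ T → π v = i := by
  obtain ⟨p, l, hp, hl, hpl, hMp, hcard⟩ :=
    exists_coprime_primes_card_quotient_gt hinf hfin M hM hM0 (Nat.card (E × E))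
  have hpP : (Ideal.span {p}).IsPrime := (Ideal.span_singleton_prime hp.ne_zero).2 hp
  have : Finite (D ⧸ Ideal.span {p}) := hfin _ (by simpa using hp.ne_zero) hpP
  have : Nontrivial (D ⧸ Ideal.span {p}) := Ideal.Quotient.nontrivial_iff.2 hpP.ne_top
  obtain ⟨Z, hZn, hZs, hZ⟩ := exists_covering_sets π hcard
  obtain ⟨N, ⟨eN⟩⟩ := Finite.exists_equiv_fin (Option E)
  set c : Option E → D := fun v => v.elim p fun _ => 1 with hc
  have hc0 : ∀ v, c v ≠ 0 := by rintro (_ | v) <;> simp [hc, hp.ne_zero]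
  have hF := fun v => exists_irreducible_eval_mod hp hl hpl
    (fun z => if z ∈ Z v then 0 else 1) (c := c v)
    (by rcases v with _ | v <;> simp [hc, hZn, hZs])
    (by rcases v with _ | v <;> simp [hc, hpl, isCoprime_one_left])
    (by rcases v with _ | v <;> simp [hc]) (eN v)
  choose F hF0 hFmod hFdeg hFprim hFirr using hF
  refine ⟨fun v => C (algebraMap D (FractionRing D) (c v))⁻¹ *
    (F v).map (algebraMap D (FractionRing D)),
    fun v => irreducible_C_mul_map (hFprim v) (hFirr v) (hc0 v), fun v w h => ?_, fun v => ?_,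
    fun T => ?_⟩
  · have := natDegree_eq_of_degree_eq (degree_eq_degree_of_associated h)
    rw [natDegree_C_mul_map (hc0 v), natDegree_C_mul_map (hc0 w), hFdeg, hFdeg] at this
    exact eN.injective (Fin.ext (add_left_cancel this))
  · have h0 : ((F v).map (algebraMap D (FractionRing D))).eval 0 =
        algebraMap D (FractionRing D) (c v) := by
      rw [← hF0 v, ← map_zero (algebraMap D (FractionRing D)), eval_map_apply]
    rw [eval_mul, eval_C, h0, inv_mul_cancel₀]
    rw [Ne, IsFractionRing.to_map_eq_zero_iff]
    exact hc0 v
  · rw [integralProd_iff_dvd hc0]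
    by_cases hT : none ∈ T
    · have hprod : ∏ v ∈ T, c v = p := by
        rw [Finset.prod_eq_single_of_mem none hT]
        · rfl
        · rintro (_ | v) _ hv
          · exact absurd rfl hv
          · rfl
      have hdvd : ∀ s, p ∣ ∏ v ∈ T, (F v).eval s ↔
          ∃ v ∈ T, Ideal.Quotient.mk (Ideal.span {p}) s ∈ Z v := by
        intro s
        rw [hp.dvd_finsetProd_iff]
        refine exists_congr fun v => and_congr_right fun _ => ?_
        rw [← Ideal.mem_span_singleton, ← Ideal.Quotient.eq_zero_iff_mem, hFmod]
        by_cases hz : Ideal.Quotient.mk (Ideal.span {p}) s ∈ Z v <;> simp [hz]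
      simp only [hprod, hdvd, hT, not_true_eq_false, false_or]
      rw [← hZ T hT]
      refine ⟨fun h z => ?_, fun h s _ => h _⟩
      obtain ⟨d, rfl⟩ := Ideal.Quotient.mk_surjective z
      obtain ⟨s, hs, t, ht, rfl⟩ := Submodule.mem_sup.1 (hMp ▸ Submodule.mem_top : d ∈ M ⊔ _)
      rw [map_add, Ideal.Quotient.eq_zero_iff_mem.2 ht, add_zero]
      exact h s hs
    · have hprod : ∏ v ∈ T, c v = 1 := by
        refine Finset.prod_eq_one ?_
        rintro (_ | v) hv
        · exact absurd hv hT
        · rfl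
      simp [hprod, hT]

end Assembly


/-- **Theorem (prescribed multisets of lengths).** Let `D` be a PID with infinitely
many maximal ideals such that every nonzero prime ideal has finite residue ring, and
let `M` be a nonzero prime ideal of `D`. For natural numbers
`1 ≤ m 0 ≤ m 1 ≤ ⋯ ≤ m (n-1)` (with `n ≥ 1`) there is a polynomial
`H ∈ Int(M,D)` having exactly `n` essentially different factorizations into
irreducible elements of `Int(M,D)`, of lengths `m 0 + 1, …, m (n-1) + 1`
(with multiplicity). -/
theorem prescribed_multisets_of_lengths
    (D : Type*) [CommRing D] [IsDomain D] [IsPrincipalIdealRing D]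
    (hinf : {I : Ideal D | I.IsMaximal}.Infinite)
    (hfin : ∀ I : Ideal D, I ≠ ⊥ → I.IsPrime → Finite (D ⧸ I))
    (M : Ideal D) (hM : M.IsPrime) (hM0 : M ≠ ⊥)
    (n : ℕ) (hn : 1 ≤ n) (m : Fin n → ℕ) (hm1 : ∀ i, 1 ≤ m i) (hmono : Monotone m) :
    ∃ H : IntS D (M : Set D), ∃ e : Fin n → Multiset (Associates (IntS D (M : Set D))),
      Function.Injective e ∧
      (∀ i, e i ∈ factorizationsOf H) ∧
      (∀ s ∈ factorizationsOf H, ∃ i, s = e i) ∧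
      (∀ i, (e i).card = m i + 1) := by
  classical
  have : Nonempty (Fin n) := ⟨⟨0, hn⟩⟩
  obtain ⟨Ψ, hirr, hassoc, h0, hA⟩ := exists_family_integralProd_iff hinf hfin M hM hM0
    (Sigma.fst : (Σ k : Fin n, Fin (m k)) → Fin n)
  set B : Fin n → Finset (Option (Σ k : Fin n, Fin (m k))) := fun k =>
    Finset.univ.map ((Function.Embedding.sigmaMk k).trans Function.Embedding.some) with hB
  have hBnone : ∀ k, none ∉ B k := fun k => by simp [hB]
  have hBsome : ∀ k v, some v ∈ B k ↔ v.1 = k := by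
    rintro k ⟨j, i⟩
    constructor
    · intro h
      obtain ⟨i', -, h⟩ := Finset.mem_map.1 h
      exact (congrArg Sigma.fst (Option.some_injective _ h)).symm
    · rintro rfl
      exact Finset.mem_map_of_mem _ (Finset.mem_univ i)
  have hdisj : ∀ j k, B j ⊆ B k → j = k := fun j k h =>
    (hBsome k ⟨j, ⟨0, hm1 j⟩⟩).1 (h ((hBsome j _).2 rfl))
  have hA' : ∀ T, IntegralProd (M : Set D) Ψ T ↔ none ∉ T ∨ ∃ k, Tᶜ ⊆ B k := by
    intro T
    rw [hA]
    by_cases hT : none ∈ T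
    · refine or_congr_right (exists_congr fun k => ⟨fun h => ?_, fun h v hv => ?_⟩)
      · rintro (_ | v) hv
        · exact absurd hT (Finset.mem_compl.1 hv)
        · exact (hBsome k v).2 (h v (Finset.mem_compl.1 hv))
      · exact (hBsome k v).1 (h (Finset.mem_compl.2 hv))
    · simp [hT]
  have hU : IntegralProd (M : Set D) Ψ Finset.univ :=
    (hA' _).2 (Or.inr ⟨⟨0, hn⟩, by simp⟩)
  have hpart := partition_iff hA' hdisj hBnone
  have hfact := mem_factorizationsOf_prod_iff M.zero_mem hirr hassoc h0 hU
  refine ⟨⟨_, hU⟩, fun k => (complSingletons (B k)).map (prodClass (M : Set D) Ψ),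
    fun j k hjk => ?_, fun k => ?_, fun s hs => ?_, fun k => ?_⟩
  · have hint : ∀ k, ∀ T ∈ complSingletons (B k), IntegralProd (M : Set D) Ψ T :=
      fun k T hT => (((hpart _).2 ⟨k, rfl⟩).1 T hT).1
    exact hdisj j k (complSingletons_inj hBnone
      (map_prodClass_injOn hirr hassoc (hint j) (hint k) hjk)).subset
  · obtain ⟨h₁, h₂⟩ := (hpart _).2 ⟨k, rfl⟩
    exact (hfact _).2 ⟨_, h₁, h₂, rfl⟩
  · obtain ⟨w, hw, hsum, rfl⟩ := (hfact s).1 hs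
    obtain ⟨k, rfl⟩ := (hpart w).1 ⟨hw, hsum⟩
    exact ⟨k, rfl⟩
  · simp [complSingletons, hB]
end

section
/- Let D be a principal ideal domain, let p be a prime element of D, and let M = (p) be the prime ideal it generates. For every natural number m ≥ 1, the polynomial H = (x/p)^{m+1} lies in Int(M,D) and has exactly one factorization into irreducible elements of Int(M,D) up to order and associates, namely H = (x/p) · (x/p) ⋯ (x/p), and this factorization has length m + 1. -/
open Polynomial

section PowerDivisors

variable {R : Type*} [CommMonoidWithZero R] [IsCancelMulZero R] {u : R}

theorem irreducible_of_dvd_pow_imp_associated_pow (h0 : u ≠ 0) (hu : ¬ IsUnit u)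
    (hdvd : ∀ n b, b ∣ u ^ n → ∃ i : ℕ, Associated b (u ^ i)) : Irreducible u := by
  refine ⟨hu, fun a b hab => ?_⟩
  obtain ⟨i, hi⟩ := hdvd 1 a (by rw [pow_one, hab]; exact dvd_mul_right a b)
  obtain ⟨j, hj⟩ := hdvd 1 b (by rw [pow_one, hab]; exact dvd_mul_left b a)
  have hij : Associated (u ^ 1) (u ^ (i + j)) := by
    rw [pow_one, pow_add]
    nth_rewrite 1 [hab]
    exact hi.mul_mul hj
  have h1 : 1 = i + j := le_antisymm
    ((pow_dvd_pow_iff h0 hu).1 hij.dvd) ((pow_dvd_pow_iff h0 hu).1 hij.symm.dvd)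
  rcases Nat.eq_zero_or_pos i with rfl | hpos
  · exact .inl (hi.isUnit_iff.2 (by simp))
  · obtain rfl : j = 0 := by omega
    exact .inr (hj.isUnit_iff.2 (by simp))

theorem factorizationsOf_pow_eq_singleton (h0 : u ≠ 0) (hu : ¬ IsUnit u)
    (hdvd : ∀ n b, b ∣ u ^ n → ∃ i : ℕ, Associated b (u ^ i)) (n : ℕ) :
    factorizationsOf (u ^ n) = {Multiset.replicate n (Associates.mk u)} := by
  have hirr := irreducible_of_dvd_pow_imp_associated_pow h0 hu hdvd
  ext s
  constructor
  · rintro ⟨hs, hprod⟩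
    have hmem : ∀ a ∈ s, a = Associates.mk u := by
      intro a ha
      have had : a ∣ Associates.mk (u ^ n) := hprod ▸ Multiset.dvd_prod ha
      have hairr := hs a ha
      obtain ⟨b, rfl⟩ := Associates.mk_surjective a
      obtain ⟨i, hi⟩ := hdvd n b (Associates.mk_dvd_mk.1 had)
      obtain rfl : i = 1 := by
        by_contra hi1
        exact not_irreducible_pow hi1 (hi.irreducible (Associates.irreducible_mk.1 hairr))
      rw [pow_one] at hi
      exact Associates.mk_eq_mk_iff_associated.2 hi
    have hrep := Multiset.eq_replicate_card.2 hmem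
    rw [hrep, Multiset.prod_replicate, ← Associates.mk_pow,
      Associates.mk_eq_mk_iff_associated] at hprod
    have hcard : Multiset.card s = n := le_antisymm
      ((pow_dvd_pow_iff h0 hu).1 hprod.dvd) ((pow_dvd_pow_iff h0 hu).1 hprod.symm.dvd)
    rwa [hcard] at hrep
  · rintro rfl
    refine ⟨fun a ha => ?_, by rw [Multiset.prod_replicate, Associates.mk_pow]⟩
    rw [Multiset.eq_of_mem_replicate ha]
    exact Associates.irreducible_mk.2 hirr

end PowerDivisors

theorem C_mem_IntS {D : Type*} [CommRing D] [IsDomain D] (S : Set D) {k : FractionRing D}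
    (hk : k ∈ (algebraMap D (FractionRing D)).range) : C k ∈ IntS D S := by
  intro s _
  rwa [eval_C]

theorem eq_C_eval_mul_pow_of_dvd_pow {K : Type*} [Field K] {q : K[X]} (hq : Prime q) {t : K}
    (ht : q.eval t = 1) {n : ℕ} {f : K[X]} (hf : f ∣ q ^ n) :
    ∃ i : ℕ, f = C (f.eval t) * q ^ i := by
  obtain ⟨i, -, v, hv⟩ := (dvd_prime_pow hq n).1 hf
  obtain ⟨k, -, hk⟩ := Polynomial.isUnit_iff.1 (v⁻¹).isUnit
  have hfk : f = C k * q ^ i := by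
    rw [hk, ← hv, mul_comm, mul_assoc, Units.mul_inv, mul_one]
  refine ⟨i, ?_⟩
  have hev : f.eval t = k := by rw [hfk]; simp [ht]
  rw [hev]
  exact hfk

/-- If `u ∈ Int(S,D)` is prime in `K[x]` and takes the value `1` at a point of `S`, then all
divisors of powers of `u` in `Int(S,D)` are associated to powers of `u`. -/
theorem IntS_associated_pow_of_dvd_pow {D : Type*} [CommRing D] [IsDomain D] {S : Set D}
    {u : IntS D S} (hu : Prime (u : (FractionRing D)[X])) {t : D} (htS : t ∈ S)
    (ht : (u : (FractionRing D)[X]).eval (algebraMap D (FractionRing D) t) = 1)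
    (n : ℕ) (b : IntS D S) (hb : b ∣ u ^ n) : ∃ i : ℕ, Associated b (u ^ i) := by
  obtain ⟨c, hc⟩ := hb
  have hmul : (u : (FractionRing D)[X]) ^ n = b * c := by
    simpa using congrArg Subtype.val hc
  obtain ⟨i, hi⟩ := eq_C_eval_mul_pow_of_dvd_pow hu ht (Dvd.intro _ hmul.symm)
  have hev := congrArg (eval (algebraMap D (FractionRing D) t)) hmul
  rw [eval_pow, ht, one_pow, eval_mul] at hev
  let kb : IntS D S := ⟨_, C_mem_IntS S (b.2 t htS)⟩
  let kc : IntS D S := ⟨_, C_mem_IntS S (c.2 t htS)⟩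
  have hk : kb * kc = 1 := by
    apply Subtype.ext
    change C _ * C _ = (1 : (FractionRing D)[X])
    rw [← C_mul, ← hev, C_1]
  refine ⟨i, Associated.symm ⟨Units.mkOfMulEqOne kb kc hk, Subtype.ext ?_⟩⟩
  rw [mul_comm]
  exact hi.symm

/-- **Theorem.** Let `D` be a PID, `p` a prime element and `M = (p)`. For every
`m ≥ 1`, the polynomial `H = (x/p)^(m+1)` lies in `Int(M,D)` and has exactly one
factorization into irreducibles of `Int(M,D)` up to order and associates, namely
`H = (x/p) ⋯ (x/p)`, of length `m + 1`. -/
theorem power_of_x_div_p_has_unique_factorization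
    (D : Type*) [CommRing D] [IsDomain D] [IsPrincipalIdealRing D]
    (p : D) (hp : Prime p) (m : ℕ) (hm : 1 ≤ m) :
    ∃ u : IntS D ((Ideal.span {p} : Ideal D) : Set D),
      (u : Polynomial (FractionRing D))
        = C ((algebraMap D (FractionRing D) p)⁻¹) * X ∧
      factorizationsOf (u ^ (m + 1))
        = {Multiset.replicate (m + 1) (Associates.mk u)} := by
  have hp0 : algebraMap D (FractionRing D) p ≠ 0 := by
    simpa using hp.ne_zero
  have hmem : C ((algebraMap D (FractionRing D) p)⁻¹) * X ∈
      IntS D ((Ideal.span {p} : Ideal D) : Set D) := by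
    intro s hs
    obtain ⟨d, rfl⟩ := Ideal.mem_span_singleton.1 hs
    exact ⟨d, by simp [hp0]⟩
  have hprime : Prime (C ((algebraMap D (FractionRing D) p)⁻¹) * X) :=
    (associated_unit_mul_right X _ (isUnit_C.2 (inv_ne_zero hp0).isUnit)).prime prime_X
  refine ⟨⟨_, hmem⟩, rfl, factorizationsOf_pow_eq_singleton ?_ ?_ ?_ _⟩
  · exact fun h => hprime.ne_zero (congrArg Subtype.val h)
  · exact fun h => hprime.not_isUnit (h.map (Subring.subtype _))
  · exact IntS_associated_pow_of_dvd_pow hprime (t := p) (Ideal.mem_span_singleton_self p)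
      (by simp [hp0])
end

section
/- Let D be a principal ideal domain that is not a field, let p be a prime element of D, and let M = (p) be the prime ideal it generates. Then the polynomial x/p belongs to Int(M,D) and is an irreducible element of the ring Int(M,D). -/
open Polynomial

/-- A constant integer-valued polynomial on `S` divides a polynomial taking the value `1` at some
point of `S` only if it is a unit. -/
theorem IntS.isUnit_of_natDegree_eq_zero {D : Type*} [CommRing D] [IsDomain D] {S : Set D}
    {a b : IntS D S} {s : D} (hs : s ∈ S)
    (ha : (a : Polynomial (FractionRing D)).natDegree = 0)
    (hab : ((a * b : IntS D S) : Polynomial (FractionRing D)).eval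
      (algebraMap D (FractionRing D) s) = 1) : IsUnit a := by
  obtain ⟨c, hc⟩ := natDegree_eq_zero.mp ha
  obtain ⟨e, he⟩ := b.2 s hs
  refine IsUnit.of_mul_eq_one
    ⟨C (algebraMap D (FractionRing D) e), fun t _ => ⟨e, by simp⟩⟩ (Subtype.ext ?_)
  rw [Subring.coe_mul, eval_mul, ← hc, eval_C, ← he] at hab
  rw [Subring.coe_mul, ← hc, ← C_mul, hab, C_1, Subring.coe_one]

/-- **Theorem.** Let `D` be a PID that is not a field, `p` a prime element of `D`
and `M = (p)`. Then `x/p` belongs to `Int(M,D)` and is an irreducible element of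
the ring `Int(M,D)`. -/
theorem x_div_p_mem_and_irreducible
    (D : Type*) [CommRing D] [IsDomain D] [IsPrincipalIdealRing D]
    (hD : ¬ IsField D) (p : D) (hp : Prime p) :
    ∃ u : IntS D ((Ideal.span {p} : Ideal D) : Set D),
      (u : Polynomial (FractionRing D))
        = C ((algebraMap D (FractionRing D) p)⁻¹) * X ∧
      Irreducible u := by
  have hp0 : algebraMap D (FractionRing D) p ≠ 0 := by
    simpa using hp.ne_zero
  have hpS : p ∈ ((Ideal.span {p} : Ideal D) : Set D) := Ideal.mem_span_singleton_self p
  refine ⟨⟨C ((algebraMap D (FractionRing D) p)⁻¹) * X, ?_⟩, rfl, ?_, ?_⟩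
  · intro s hs
    obtain ⟨d, rfl⟩ := Ideal.mem_span_singleton.mp hs
    exact ⟨d, by simp [hp0]⟩
  · intro hu
    have h := natDegree_eq_zero_of_isUnit (hu.map (IntS D _).subtype)
    rw [Subring.subtype_apply, natDegree_C_mul_X _ (inv_ne_zero hp0)] at h
    exact one_ne_zero h
  · intro a b hab
    have hab' : C ((algebraMap D (FractionRing D) p)⁻¹) * X
        = (a : Polynomial (FractionRing D)) * (b : Polynomial (FractionRing D)) :=
      congrArg Subtype.val hab
    have hval : ((a * b : IntS D _) : Polynomial (FractionRing D)).eval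
        (algebraMap D (FractionRing D) p) = 1 := by
      rw [← hab]
      simp [hp0]
    have hne : (a : Polynomial (FractionRing D)) * (b : Polynomial (FractionRing D)) ≠ 0 := by
      rw [← hab']
      simp [hp.ne_zero]
    have hdeg := congrArg natDegree hab'
    rw [natDegree_C_mul_X _ (inv_ne_zero hp0),
      natDegree_mul (left_ne_zero_of_mul hne) (right_ne_zero_of_mul hne)] at hdeg
    have hcases : (a : Polynomial (FractionRing D)).natDegree = 0 ∨
        (b : Polynomial (FractionRing D)).natDegree = 0 := by omega
    rcases hcases with h | h
    · exact Or.inl (IntS.isUnit_of_natDegree_eq_zero hpS h hval)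
    · exact Or.inr (IntS.isUnit_of_natDegree_eq_zero hpS h (by rwa [mul_comm b a]))
end

section
/- Let D be a principal ideal domain with infinitely many maximal ideals such that for every nonzero prime ideal M' of D the residue ring D/M' is finite. Let p be a prime element of D and M = (p). Then for every n ≥ 1 there exist elements H, G_1, ..., G_{n+1} of Int(M,D), each irreducible in Int(M,D), such that (x/p) · H = G_1 · G_2 ⋯ G_{n+1} in Int(M,D) (where x/p is itself an irreducible element of Int(M,D)). -/
open Polynomial

namespace Polynomial

lemma eval_map_algebraMap_algebraMap {R A : Type*} [CommSemiring R] [CommSemiring A] [Algebra R A]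
    (P : R[X]) (d : R) :
    (P.map (algebraMap R A)).eval (algebraMap R A d) = algebraMap R A (P.eval d) := by
  rw [eval_map_algebraMap, aeval_algebraMap_apply, coe_aeval_eq_eval]

/-- A polynomial with nonzero constant coefficient is irreducible if its reverse is. -/
lemma irreducible_of_irreducible_reverse {F : Type*} [Field F] {f : F[X]}
    (h0 : f.coeff 0 ≠ 0) (h : Irreducible f.reverse) : Irreducible f := by
  have hunit : ∀ a : F[X], a.coeff 0 ≠ 0 → IsUnit a.reverse → IsUnit a := by
    intro a ha hu
    have hd := natDegree_eq_zero_of_isUnit hu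
    rw [reverse_natDegree, natTrailingDegree_eq_zero.2 (Or.inr ha), tsub_zero] at hd
    rw [eq_C_of_natDegree_eq_zero hd]
    exact isUnit_C.2 (isUnit_iff_ne_zero.2 ha)
  refine ⟨fun hu => h.not_isUnit ?_, ?_⟩
  · obtain ⟨c, hc, rfl⟩ := isUnit_iff.1 hu
    simpa using hc
  · rintro a b rfl
    rw [mul_coeff_zero] at h0
    rw [reverse_mul_of_domain] at h
    exact (h.isUnit_or_isUnit rfl).imp (hunit a (left_ne_zero_of_mul h0))
      (hunit b (right_ne_zero_of_mul h0))

/-- If the prime `r` divides `e` exactly once, then `1 - e x ^ (k + 1) (x - Q)` is irreducible,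
by Eisenstein's criterion applied to the reversed polynomial. -/
lemma irreducible_map_one_sub_mul {D : Type*} [CommRing D] [IsDomain D] [IsIntegrallyClosed D]
    {r e : D} (Q : D) (hr : Prime r) (hre : r ∣ e) (hre2 : ¬ r ^ 2 ∣ e) (k : ℕ) :
    Irreducible ((1 - C e * X ^ (k + 1) * (X - C Q)).map
      (algebraMap D (FractionRing D))) := by
  set φ : D[X] := X ^ (k + 2) + (C (e * Q) * X - C e) with hφ
  have he : e ≠ 0 := by
    rintro rfl
    exact hre2 (dvd_zero _)
  have hdeg : (C (e * Q) * X - C e : D[X]).degree < ((k + 2 : ℕ) : WithBot ℕ) := by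
    refine lt_of_le_of_lt (b := 1) ?_ (by exact_mod_cast (by omega : 1 < k + 2))
    compute_degree
  have hmonic : φ.Monic := monic_X_pow_add hdeg
  have hφdeg : φ.degree = ((k + 2 : ℕ) : WithBot ℕ) := by
    rw [hφ, degree_add_eq_left_of_degree_lt (by rwa [degree_X_pow]), degree_X_pow]
  have hcoeff0 : φ.coeff 0 = -e := by simp [hφ]
  have hirr : Irreducible φ := by
    refine irreducible_of_eisenstein_criterion (P := Ideal.span {r})
      ((Ideal.span_singleton_prime hr.ne_zero).2 hr) ?_ ?_ ?_ ?_ hmonic.isPrimitive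
    · rw [hmonic.leadingCoeff, Ideal.mem_span_singleton]
      exact fun h => hr.not_isUnit (isUnit_of_dvd_one h)
    · intro n hn
      rw [hφdeg] at hn
      have hn' : n ≠ k + 2 := by
        have : n < k + 2 := by exact_mod_cast hn
        omega
      have : φ.coeff n = e * (C Q * X - 1 : D[X]).coeff n := by
        rw [← coeff_C_mul, hφ, coeff_add, coeff_X_pow, if_neg hn', zero_add]
        congr 1
        simp only [C_mul]
        ring
      rw [Ideal.mem_span_singleton, this]
      exact hre.mul_right _
    · rw [hφdeg]
      exact_mod_cast (by omega : 0 < k + 2)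
    · rw [hcoeff0, Ideal.span_singleton_pow, Ideal.mem_span_singleton, dvd_neg]
      exact hre2
  have hirrK := hmonic.irreducible_iff_irreducible_map_fraction_map (K := FractionRing D) |>.1 hirr
  set ι := algebraMap D (FractionRing D)
  have hιe : ι e ≠ 0 := by
    simpa [ι] using he
  have hmap : (1 - C e * X ^ (k + 1) * (X - C Q)).map ι =
      X ^ (k + 1) * (C (-ι e) * X + C (ι (e * Q))) + C 1 := by
    simp only [Polynomial.map_sub, Polynomial.map_mul, Polynomial.map_pow, Polynomial.map_one,
      map_C, map_X, map_mul, C_neg, C_1]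
    ring
  have hnd : (C (-ι e) * X + C (ι (e * Q))).natDegree = 1 :=
    natDegree_linear (neg_ne_zero.2 hιe)
  have hnd' : (X ^ (k + 1) * (C (-ι e) * X + C (ι (e * Q)))).natDegree = k + 2 := by
    rw [natDegree_mul (by simp) (ne_zero_of_natDegree_gt (n := 0) (by omega)), hnd, natDegree_X_pow]
  apply irreducible_of_irreducible_reverse
  · rw [hmap]
    simp
  · have : ((1 - C e * X ^ (k + 1) * (X - C Q)).map ι).reverse = φ.map ι := by
      rw [hmap, reverse_add_C, hnd', reverse_X_pow_mul, reverse_add_C, reverse_mul_X, reverse_C,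
        natDegree_C_mul_X _ (neg_ne_zero.2 hιe), hφ]
      simp only [Polynomial.map_sub, Polynomial.map_add, Polynomial.map_mul, Polynomial.map_pow,
        map_C, map_X, map_mul, C_neg, C_1]
      ring
    rw [this]
    exact hirrK

end Polynomial

namespace IntS

variable {D : Type*} [CommRing D] [IsDomain D]

local notation "K" => FractionRing D
local notation "ι" => algebraMap D (FractionRing D)

/-- If `Q` divides all values of `P`, then `P / Q` is integer-valued. -/
lemma exists_coe_eq_C_inv_mul_map {Q : D} (hQ : Q ≠ 0) {P : D[X]} (h : ∀ d, Q ∣ P.eval d)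
    (S : Set D) : ∃ F : IntS D S, (F : K[X]) = C (ι Q)⁻¹ * P.map ι := by
  refine ⟨⟨C (ι Q)⁻¹ * P.map ι, fun d _ => ?_⟩, rfl⟩
  obtain ⟨y, hy⟩ := h d
  refine ⟨y, ?_⟩
  have : ι Q ≠ 0 := by simpa using hQ
  rw [eval_mul, eval_C, eval_map_algebraMap_algebraMap, hy, map_mul,
    inv_mul_cancel_left₀ this]

lemma map_mem (P : D[X]) (S : Set D) : P.map ι ∈ IntS D S := by
  intro d _
  exact ⟨P.eval d, (eval_map_algebraMap_algebraMap P d).symm⟩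

lemma isUnit_of_eq_C {S : Set D} {d : D} (hd : d ∈ S) {A B : IntS D S} {c : K}
    (hA : (A : K[X]) = C c) (h : ((A * B : IntS D S) : K[X]).eval (ι d) = 1) : IsUnit A := by
  have hc : c * (B : K[X]).eval (ι d) = 1 := by
    simpa [hA] using h
  refine IsUnit.of_mul_eq_one ⟨C ((B : K[X]).eval (ι d)), fun s _ => ?_⟩ ?_
  · rw [eval_C]
    exact B.2 d hd
  · apply Subtype.ext
    simp [hA, ← C_mul, hc]

/-- A criterion for irreducibility of an integer-valued polynomial taking the value `1`
in terms of its factorization over the quotient field. -/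
lemma irreducible_of_eq_mul_prod {S : Set D} {d : D} (hd : d ∈ S) {F : IntS D S}
    (hF : (F : K[X]).eval (ι d) = 1) {α : Type*} [Fintype α] [DecidableEq α]
    {a : K[X]} {P : α → K[X]}
    (ha : Irreducible a) (hP : ∀ i, Irreducible (P i)) (hFa : (F : K[X]) = a * ∏ i, P i)
    (hsplit : ∀ (t u : Finset α) (c : K), c ≠ 0 → t ∪ u = Finset.univ → Disjoint t u →
      C c * (a * ∏ i ∈ u, P i) ∈ IntS D S → C c⁻¹ * ∏ i ∈ t, P i ∈ IntS D S → t = ∅) :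
    Irreducible F := by
  have key : ∀ (A B : IntS D S) (t u : Finset α) (b c : K[X]), A * B = F →
      t ∪ u = Finset.univ → Disjoint t u → a = b * c → (A : K[X]) = b * ∏ i ∈ t, P i →
      (B : K[X]) = c * ∏ i ∈ u, P i → IsUnit b → IsUnit A := by
    intro A B t u b c hAB htu hdis habc hA hB hb
    obtain ⟨y, hy, rfl⟩ := isUnit_iff.1 hb
    have hy0 : y ≠ 0 := hy.ne_zero
    have hc : c = C y⁻¹ * a := by
      rw [habc, ← mul_assoc, ← C_mul, inv_mul_cancel₀ hy0, C_1, one_mul]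
    have ht : t = ∅ := by
      refine hsplit t u y⁻¹ (inv_ne_zero hy0) htu hdis ?_ ?_
      · rw [← mul_assoc, ← hc, ← hB]
        exact B.2
      · rw [inv_inv, ← hA]
        exact A.2
    subst ht
    rw [Finset.prod_empty, mul_one] at hA
    exact isUnit_of_eq_C hd hA (B := B) (by rw [hAB, hF])
  refine ⟨fun hu => ?_, fun A B hAB => ?_⟩
  · have := hu.map (IntS D S).subtype
    rw [Subring.subtype_apply, hFa] at this
    exact ha.not_isUnit (isUnit_of_mul_isUnit_left this)
  · have hAB' : (A : K[X]) * B = a * ∏ i, P i := by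
      rw [← hFa, hAB]
      rfl
    obtain ⟨t, u, b, c, htu, hdis, habc, hA, hB⟩ :=
      mul_eq_mul_prime_prod (fun i _ => (hP i).prime) hAB'
    rcases ha.isUnit_or_isUnit habc with hb | hc
    · exact Or.inl (key A B t u b c hAB.symm htu hdis habc hA hB hb)
    · refine Or.inr (key B A u t c b ?_ ?_ hdis.symm ?_ hB hA hc)
      · rw [mul_comm, hAB]
      · rw [Finset.union_comm, htu]
      · rw [mul_comm, habc]

lemma irreducible_of_irreducible_coe {S : Set D} {d : D} (hd : d ∈ S) {F : IntS D S}
    (hF : (F : K[X]).eval (ι d) = 1) (hirr : Irreducible (F : K[X])) : Irreducible F :=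
  irreducible_of_eq_mul_prod hd hF (α := Empty) (P := Empty.elim) hirr (fun i => i.elim)
    (by simp) (fun t _ _ _ _ _ _ _ => Subsingleton.elim _ _)

/-- Rescaling the variable by `p` identifies `Int((p), D)` with `Int(D, D)`. -/
lemma exists_ringEquiv {p : D} (hp : p ≠ 0) :
    ∃ e : IntS D Set.univ ≃+* IntS D ((Ideal.span {p} : Ideal D) : Set D),
      ∀ f, (e f : K[X]) = (f : K[X]).comp (C (ι p)⁻¹ * X) := by
  have hp' : ι p ≠ 0 := by simpa using hp
  have h1 : ∀ f : K[X], (f.comp (C (ι p)⁻¹ * X)).comp (C (ι p) * X) = f := by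
    intro f
    rw [comp_assoc]
    simp [← mul_assoc, ← C_mul, hp']
  have h2 : ∀ f : K[X], (f.comp (C (ι p) * X)).comp (C (ι p)⁻¹ * X) = f := by
    intro f
    rw [comp_assoc]
    simp [← mul_assoc, ← C_mul, hp']
  refine ⟨{ toFun := fun f => ⟨(f : K[X]).comp (C (ι p)⁻¹ * X), ?_⟩
            invFun := fun f => ⟨(f : K[X]).comp (C (ι p) * X), ?_⟩
            left_inv := fun f => Subtype.ext (h1 f)
            right_inv := fun f => Subtype.ext (h2 f)
            map_mul' := fun f g => Subtype.ext (by simp)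
            map_add' := fun f g => Subtype.ext (by simp) }, fun f => rfl⟩
  · intro s hs
    obtain ⟨d, rfl⟩ := Ideal.mem_span_singleton.1 hs
    have := f.2 d (Set.mem_univ d)
    simpa [eval_comp, hp'] using this
  · intro d _
    have := f.2 (p * d) (Ideal.mem_span_singleton.2 (dvd_mul_right p d))
    simpa [eval_comp] using this

end IntS

/-- In a principal ideal domain with infinitely many maximal ideals there is an infinite sequence
of pairwise coprime primes. -/
lemma exists_primes_pairwise_isCoprime {D : Type*} [CommRing D] [IsDomain D]
    [IsPrincipalIdealRing D] (hinf : {I : Ideal D | I.IsMaximal}.Infinite) :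
    ∃ q : ℕ → D, (∀ i, Prime (q i)) ∧ Pairwise fun i j => IsCoprime (q i) (q j) := by
  have hinf' := hinf.sdiff (Set.finite_singleton (⊥ : Ideal D))
  let f := hinf'.natEmbedding
  have hmax : ∀ i, (f i : Ideal D).IsMaximal := fun i => (f i).2.1
  have hbot : ∀ i, (f i : Ideal D) ≠ ⊥ := fun i => (f i).2.2
  refine ⟨fun i => Submodule.IsPrincipal.generator (f i : Ideal D), fun i => ?_, fun i j hij => ?_⟩
  · have := (hmax i).isPrime
    exact Submodule.IsPrincipal.prime_generator_of_isPrime _ (hbot i)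
  · beta_reduce
    rw [← Ideal.isCoprime_span_singleton_iff, Ideal.span_singleton_generator,
      Ideal.span_singleton_generator]
    exact Ideal.isCoprime_of_isMaximal fun h => hij (f.injective (Subtype.ext h))

/-- Fermat's little theorem modulo a prime element with finite residue ring. -/
lemma Prime.exists_dvd_pow_sub_one {D : Type*} [CommRing D] [IsDomain D]
    {q : D} (hq : Prime q) (hfin : Finite (D ⧸ Ideal.span {q})) :
    ∃ m, 0 < m ∧ ∀ a, ¬ q ∣ a → q ∣ a ^ m - 1 := by
  have hprime : (Ideal.span {q}).IsPrime := (Ideal.span_singleton_prime hq.ne_zero).2 hq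
  refine ⟨Nat.card (D ⧸ Ideal.span {q})ˣ, Nat.card_pos, fun a ha => ?_⟩
  have ha' : Ideal.Quotient.mk (Ideal.span {q}) a ≠ 0 := by
    rwa [Ne, Ideal.Quotient.eq_zero_iff_mem, Ideal.mem_span_singleton]
  obtain ⟨u, hu⟩ : IsUnit (Ideal.Quotient.mk (Ideal.span {q}) a) :=
    IsUnit.of_mul_eq_one _ ((Finite.isField_of_domain _).mul_inv_cancel ha').choose_spec
  rw [← Ideal.mem_span_singleton, ← Ideal.Quotient.eq_zero_iff_mem, map_sub, map_pow, ← hu,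
    ← Units.val_pow_eq_pow_val, pow_card_eq_one', map_one, Units.val_one, sub_self]

/-- There is an irreducible polynomial which takes the value `1` at `0` and at `∏ i, q i`,
and whose values at elements not divisible by `q i` are divisible by `q i`. -/
lemma exists_irreducible_dvd_eval {D : Type*} [CommRing D] [IsDomain D]
    [IsIntegrallyClosed D] {α : Type*} [Fintype α] {q : α → D}
    (hq : ∀ i, Prime (q i)) (hfin : ∀ i, Finite (D ⧸ Ideal.span {q i}))
    {r : D} (hr : Prime r) (hqr : ∀ i, IsCoprime (q i) r) :
    ∃ f : D[X], Irreducible (f.map (algebraMap D (FractionRing D))) ∧ f.eval 0 = 1 ∧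
      f.eval (∏ i, q i) = 1 ∧ ∀ i a, ¬ q i ∣ a → q i ∣ f.eval a := by
  choose m hm0 hm using fun i => (hq i).exists_dvd_pow_sub_one (hfin i)
  obtain ⟨k, hk⟩ : ∃ k, k + 2 = 2 * ∏ i, m i :=
    ⟨2 * ∏ i, m i - 2, by have := Finset.prod_pos fun i (_ : i ∈ Finset.univ) => hm0 i; omega⟩
  set Q := ∏ i, q i with hQ
  obtain ⟨α, β, hαβ⟩ : IsCoprime (r ^ 2) Q :=
    (IsCoprime.prod_right fun i _ => (hqr i).symm).pow_left
  set e := r + (1 - r) * α * r ^ 2 with he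
  have he1 : Q ∣ 1 - e := ⟨(1 - r) * β, by linear_combination (r - 1) * hαβ⟩
  have hre : r ∣ e := ⟨1 + (1 - r) * α * r, by ring⟩
  have hre2 : ¬ r ^ 2 ∣ e := by
    intro h
    rw [he, dvd_add_left (dvd_mul_left _ _)] at h
    have h' : r * r ∣ r * 1 := by simpa [pow_two] using h
    exact hr.not_isUnit (isUnit_of_dvd_one ((mul_dvd_mul_iff_left hr.ne_zero).1 h'))
  refine ⟨1 - C e * X ^ (k + 1) * (X - C Q), irreducible_map_one_sub_mul Q hr hre hre2 k,
    by simp, by simp, fun i a ha => ?_⟩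
  have hiQ : q i ∣ Q := Finset.dvd_prod_of_mem q (Finset.mem_univ i)
  have hpow : q i ∣ a ^ (k + 2) - 1 := by
    have hmi : m i ∣ k + 2 := hk ▸ (Finset.dvd_prod_of_mem m (Finset.mem_univ i)).mul_left 2
    obtain ⟨l, hl⟩ := hmi
    rw [hl, pow_mul]
    exact (hm i a ha).trans (sub_one_dvd_pow_sub_one _ _)
  have heval : (1 - C e * X ^ (k + 1) * (X - C Q)).eval a =
      (1 - e) * a ^ (k + 2) + e * a ^ (k + 1) * Q - (a ^ (k + 2) - 1) := by
    simp only [eval_sub, eval_mul, eval_one, eval_C, eval_pow, eval_X]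
    ring
  rw [heval]
  exact dvd_sub (dvd_add ((hiQ.trans he1).mul_right _) (hiQ.mul_left _)) hpow

namespace IntS

variable {D : Type*} [CommRing D] [IsDomain D]

local notation "ι" => algebraMap D (FractionRing D)

lemma irreducible_C_inv_mul_map {Q : D} (hQ : Q ≠ 0) {f : D[X]} (hf : Irreducible (f.map ι)) :
    Irreducible (C (ι Q)⁻¹ * f.map ι) := by
  have hιQ : ι Q ≠ 0 := by simpa using hQ
  exact (irreducible_isUnit_mul (isUnit_C.2 (isUnit_iff_ne_zero.2 (inv_ne_zero hιQ)))).2 hf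

/-- Every factor `g i` is needed to cancel the denominator `q i` at `0`. -/
lemma irreducible_of_eq_mul_prod_div_prod {S : Set D} (hS0 : 0 ∈ S) (hS1 : 1 ∈ S)
    {α : Type*} [Fintype α] [DecidableEq α] {q : α → D} (hq : ∀ i, Prime (q i)) {f : D[X]}
    (hf : Irreducible (f.map ι)) (hf0 : f.eval 0 = 1) {g : α → D[X]}
    (hg : ∀ i, Irreducible ((g i).map ι)) (hg0 : ∀ i, (g i).eval 0 = q i)
    (hg1 : ∀ i, (g i).eval 1 = 1) {H : IntS D S}
    (hH : (H : (FractionRing D)[X]) = C (ι (∏ i, q i))⁻¹ * (f * ∏ i, g i).map ι) :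
    Irreducible H := by
  have hQ0 : ∏ i, q i ≠ 0 := Finset.prod_ne_zero_iff.2 fun i _ => (hq i).ne_zero
  have hιQ : ι (∏ i, q i) ≠ 0 := by
    rwa [Ne, map_eq_zero_iff _ (IsFractionRing.injective D (FractionRing D))]
  refine irreducible_of_eq_mul_prod hS0 (a := C (ι (∏ i, q i))⁻¹ * f.map ι)
    (P := fun i => (g i).map ι) ?_ (irreducible_C_inv_mul_map hQ0 hf) hg ?_ ?_
  · rw [hH, eval_mul, eval_C, eval_map_algebraMap_algebraMap, eval_mul, eval_prod, hf0, one_mul,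
      Finset.prod_congr rfl fun i _ => hg0 i, inv_mul_cancel₀ hιQ]
  · rw [hH, Polynomial.map_mul, Polynomial.map_prod, mul_assoc]
  · intro t v c hc htv hdis h1 h2
    obtain ⟨y, hy⟩ := h1 0 hS0
    obtain ⟨z, hz⟩ := h2 1 hS1
    simp only [eval_mul, eval_prod, eval_C, eval_map_algebraMap_algebraMap, hf0, hg0, hg1] at hy hz
    simp only [map_one, mul_one, Finset.prod_const_one] at hy hz
    have hprod : ι (∏ i, q i) = (∏ i ∈ t, ι (q i)) * ∏ i ∈ v, ι (q i) := by
      rw [← Finset.prod_union hdis, htv, map_prod]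
    have hcy : c = ι y * ∏ i ∈ t, ι (q i) := by
      rw [hy, mul_assoc, mul_assoc, mul_comm (∏ i ∈ v, _), ← hprod, inv_mul_cancel₀ hιQ, mul_one]
    have hone : (z * y) * ∏ i ∈ t, q i = 1 := by
      apply IsFractionRing.injective D (FractionRing D)
      rw [map_mul, map_mul, map_prod, hz, mul_assoc, ← hcy, inv_mul_cancel₀ hc, map_one]
    by_contra ht
    obtain ⟨i, hi⟩ := Finset.nonempty_iff_ne_empty.2 ht
    exact (hq i).not_isUnit (isUnit_of_dvd_one
      (((Finset.dvd_prod_of_mem q hi).mul_left _).trans hone.dvd))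

lemma irreducible_of_eq_mul_X_div {S : Set D} (hS0 : 0 ∈ S) (hS1 : 1 ∈ S) {Q : D} (hSQ : Q ∈ S)
    (hQ : Q ≠ 0) (hQunit : ¬ IsUnit Q) {f : D[X]} (hf : Irreducible (f.map ι))
    (hf0 : f.eval 0 = 1) (hfQ : f.eval Q = 1) {G : IntS D S}
    (hG : (G : (FractionRing D)[X]) = C (ι Q)⁻¹ * (f * X).map ι) :
    Irreducible G := by
  have hιQ : ι Q ≠ 0 := by simpa using hQ
  refine irreducible_of_eq_mul_prod hSQ (a := C (ι Q)⁻¹ * f.map ι)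
    (P := fun _ : Unit => X) ?_ (irreducible_C_inv_mul_map hQ hf) (fun _ => irreducible_X) ?_ ?_
  · rw [hG, eval_mul, eval_C, eval_map_algebraMap_algebraMap, eval_mul, eval_X, hfQ, one_mul,
      inv_mul_cancel₀ hιQ]
  · simp [hG, mul_assoc]
  · intro t v c hc htv hdis h1 h2
    by_contra ht
    obtain rfl : t = Finset.univ := by
      rw [Finset.eq_univ_iff_forall]
      obtain ⟨i, hi⟩ := Finset.nonempty_iff_ne_empty.2 ht
      exact fun j => Subsingleton.elim i j ▸ hi
    obtain rfl : v = ∅ := Finset.eq_empty_of_forall_notMem fun i =>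
      Finset.disjoint_left.1 hdis (Finset.mem_univ i)
    obtain ⟨y, hy⟩ := h1 0 hS0
    obtain ⟨z, hz⟩ := h2 1 hS1
    simp only [eval_mul, eval_C, Finset.prod_empty, mul_one, eval_map_algebraMap_algebraMap, hf0,
      map_one] at hy
    have hz' : ι z = c⁻¹ := by simpa using hz
    refine hQunit (IsUnit.of_mul_eq_one (z * y) ?_)
    apply IsFractionRing.injective D (FractionRing D)
    rw [map_mul, map_mul, hz', hy, map_one]
    field_simp

/-- In `Int(D, D)`, the product of `x` with a suitable irreducible element is a product of
`n + 1` irreducible elements. -/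
lemma exists_X_mul_eq_prod [IsPrincipalIdealRing D]
    (hinf : {I : Ideal D | I.IsMaximal}.Infinite)
    (hfin : ∀ I : Ideal D, I ≠ ⊥ → I.IsPrime → Finite (D ⧸ I)) (n : ℕ) (hn : 1 ≤ n) :
    ∃ u H : IntS D (Set.univ : Set D), (u : (FractionRing D)[X]) = X ∧
      Irreducible u ∧ Irreducible H ∧
      ∃ G : Fin (n + 1) → IntS D (Set.univ : Set D),
        (∀ i, Irreducible (G i)) ∧ u * H = ∏ i, G i := by
  obtain ⟨q', hq', hcop'⟩ := exists_primes_pairwise_isCoprime hinf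
  obtain ⟨q, r, hq, hr, hcop, hqr⟩ : ∃ (q : Fin n → D) (r : D), (∀ i, Prime (q i)) ∧ Prime r ∧
      (Pairwise fun i j => IsCoprime (q i) (q j)) ∧ ∀ i, IsCoprime (q i) r :=
    ⟨fun i => q' i, q' n, fun i => hq' i, hq' n,
      fun i j hij => hcop' (Fin.val_injective.ne hij), fun i => hcop' i.2.ne⟩
  obtain ⟨f, hfirr, hf0, hfQ, hfdvd⟩ := exists_irreducible_dvd_eval hq
    (fun i => hfin _ (by simpa using (hq i).ne_zero)
      ((Ideal.span_singleton_prime (hq i).ne_zero).2 (hq i))) hr hqr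
  have hQ0 : ∏ i, q i ≠ 0 := Finset.prod_ne_zero_iff.2 fun i _ => (hq i).ne_zero
  have hQunit : ¬ IsUnit (∏ i, q i) := fun h => (hq ⟨0, hn⟩).not_isUnit
    (isUnit_of_dvd_unit (Finset.dvd_prod_of_mem q (Finset.mem_univ _)) h)
  have hQdvd : ∀ x, (∀ i, q i ∣ x) → ∏ i, q i ∣ x := fun x hx =>
    Finset.prod_dvd_of_coprime (fun i _ j _ hij => hcop hij) fun i _ => hx i
  obtain ⟨g, hg⟩ : ∃ g : Fin n → D[X], ∀ i, g i = C (1 - q i) * X + C (q i) :=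
    ⟨_, fun _ => rfl⟩
  have hg0 : ∀ i, (g i).eval 0 = q i := fun i => by simp [hg]
  have hg1 : ∀ i, (g i).eval 1 = 1 := fun i => by simp [hg]
  have hgirr : ∀ i, Irreducible ((g i).map ι) := by
    intro i
    refine irreducible_of_degree_eq_one ?_
    have h1 : ι (1 - q i) ≠ 0 := by
      intro h
      have h' : 1 - q i = 0 :=
        (map_eq_zero_iff ι (IsFractionRing.injective D (FractionRing D))).1 h
      exact (hq i).not_isUnit (by rw [← sub_eq_zero.1 h']; exact isUnit_one)
    simpa only [hg, Polynomial.map_add, Polynomial.map_mul, map_C, map_X] using degree_linear h1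
  have hHdvd : ∀ d, ∏ i, q i ∣ (f * ∏ i, g i).eval d := by
    intro d
    refine hQdvd _ fun i => ?_
    rw [eval_mul, eval_prod]
    by_cases hid : q i ∣ d
    · have hgi : q i ∣ (g i).eval d := by simpa [hg] using hid.mul_left (1 - q i)
      exact (hgi.trans
        (Finset.dvd_prod_of_mem (fun j => (g j).eval d) (Finset.mem_univ i))).mul_left _
    · exact (hfdvd i d hid).mul_right _
  have hGdvd : ∀ d, ∏ i, q i ∣ (f * X).eval d := by
    intro d
    refine hQdvd _ fun i => ?_
    rw [eval_mul, eval_X]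
    by_cases hid : q i ∣ d
    · exact hid.mul_left _
    · exact (hfdvd i d hid).mul_right _
  obtain ⟨u, hu⟩ : ∃ u : IntS D (Set.univ : Set D), (u : (FractionRing D)[X]) = X :=
    ⟨⟨(X : D[X]).map ι, map_mem _ _⟩, Polynomial.map_X ι⟩
  obtain ⟨H, hH⟩ := exists_coe_eq_C_inv_mul_map hQ0 hHdvd Set.univ
  obtain ⟨G, hG⟩ := exists_coe_eq_C_inv_mul_map hQ0 hGdvd Set.univ
  obtain ⟨g', hg'⟩ : ∃ g' : Fin n → IntS D (Set.univ : Set D),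
      ∀ i, (g' i : (FractionRing D)[X]) = (g i).map ι :=
    ⟨fun i => ⟨(g i).map ι, map_mem _ _⟩, fun _ => rfl⟩
  refine ⟨u, H, hu, ?_, ?_, Fin.cons G g', ?_, ?_⟩
  · refine irreducible_of_irreducible_coe (Set.mem_univ 1) ?_ ?_
    · rw [hu, eval_X, map_one]
    · rw [hu]
      exact irreducible_X
  · exact irreducible_of_eq_mul_prod_div_prod (Set.mem_univ _) (Set.mem_univ _) hq hfirr hf0
      hgirr hg0 hg1 hH
  · refine Fin.cases ?_ fun i => ?_
    · rw [Fin.cons_zero]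
      exact irreducible_of_eq_mul_X_div (Set.mem_univ _) (Set.mem_univ _) (Set.mem_univ _) hQ0
        hQunit hfirr hf0 hfQ hG
    · rw [Fin.cons_succ]
      refine irreducible_of_irreducible_coe (Set.mem_univ 1) ?_ (hg' i ▸ hgirr i)
      rw [hg', eval_map_algebraMap_algebraMap, hg1, map_one]
  · rw [Fin.prod_cons]
    apply Subtype.ext
    rw [Subring.coe_mul, Subring.coe_mul, SubmonoidClass.coe_finsetProd]
    simp only [hu, hH, hG, hg', Polynomial.map_mul, Polynomial.map_prod, map_X]
    ring

end IntS

/-- **Theorem (non-transfer-Krull construction).** Let `D` be a PID with infinitely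
many maximal ideals such that every nonzero prime ideal has finite residue ring.
Let `p` be a prime element of `D` and `M = (p)`. Then for every `n ≥ 1` there exist
irreducible elements `H, G 0, …, G n` of `Int(M,D)` such that
`(x/p) · H = G 0 ⋯ G n`, where `x/p` is itself an irreducible element of `Int(M,D)`. -/
theorem x_div_p_times_irreducible_long_factorizations
    (D : Type*) [CommRing D] [IsDomain D] [IsPrincipalIdealRing D]
    (hinf : {I : Ideal D | I.IsMaximal}.Infinite)
    (hfin : ∀ I : Ideal D, I ≠ ⊥ → I.IsPrime → Finite (D ⧸ I))
    (p : D) (hp : Prime p) (n : ℕ) (hn : 1 ≤ n) :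
    ∃ u H : IntS D ((Ideal.span {p} : Ideal D) : Set D),
      (u : Polynomial (FractionRing D))
        = C ((algebraMap D (FractionRing D) p)⁻¹) * X ∧
      Irreducible u ∧ Irreducible H ∧
      ∃ G : Fin (n + 1) → IntS D ((Ideal.span {p} : Ideal D) : Set D),
        (∀ i, Irreducible (G i)) ∧ u * H = ∏ i, G i := by
  obtain ⟨u, H, hu, hui, hH, G, hG, h⟩ := IntS.exists_X_mul_eq_prod hinf hfin n hn
  obtain ⟨e, he⟩ := IntS.exists_ringEquiv hp.ne_zero
  refine ⟨e u, e H, ?_, (MulEquiv.irreducible_iff e).2 hui, (MulEquiv.irreducible_iff e).2 hH,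
    fun i => e (G i), fun i => (MulEquiv.irreducible_iff e).2 (hG i), ?_⟩
  · rw [he, hu, X_comp]
  · rw [← map_mul, h, map_prod]
end

section
/- Let D be a principal ideal domain with infinitely many maximal ideals such that for every nonzero prime ideal M' of D the residue ring D/M' is finite. Let p be a prime element of D and M = (p). Then there exists an irreducible element u of Int(M,D) (namely u = x/p) such that the factorization lengths of products u·H over irreducible H are unbounded: for every natural number N there exists an irreducible element H of Int(M,D) such that u·H admits a factorization into more than N irreducible elements of Int(M,D). (In particular, the lengths of factorizations of products of u with a second irreducible element are not bounded by any constant depending only on u.) -/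
open Polynomial

namespace IntS

variable {D : Type*} [CommRing D]

/-- The linear polynomial with value `q` at `0` and value `1` at `1`. -/
noncomputable def lin (q : D) : D[X] := C (1 - q) * X + C q

@[simp] lemma eval_lin (q a : D) : (lin q).eval a = (1 - q) * a + q := by simp [lin]

lemma natDegree_map_lin {q : D} (hq : q ≠ 1) :
    ((lin q).map (algebraMap D (FractionRing D))).natDegree = 1 := by
  rw [natDegree_map_eq_of_injective (IsFractionRing.injective D (FractionRing D))]
  exact natDegree_linear (sub_ne_zero.mpr hq.symm)

lemma dvd_mul_pow_sub {q c : D} (hmax : (Ideal.span {q}).IsMaximal)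
    (hqc : q ∣ 1 - c) {m : ℕ} (hm : Nat.card (D ⧸ Ideal.span {q})ˣ ∣ m) (a : D) :
    q ∣ a * (a ^ m - c) := by
  let _ := Ideal.Quotient.field (Ideal.span {q})
  rw [← Ideal.mem_span_singleton, ← Ideal.Quotient.eq_zero_iff_mem] at hqc ⊢
  rw [map_sub, map_one, sub_eq_zero] at hqc
  rw [map_mul, map_sub, map_pow, ← hqc, mul_eq_zero, or_iff_not_imp_left]
  intro ha
  obtain ⟨k, rfl⟩ := hm
  have h := congrArg Units.val (pow_card_eq_one' (x := Units.mk0 _ ha))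
  rw [Units.val_pow_eq_pow_val, Units.val_mk0, Units.val_one] at h
  rw [pow_mul, h, one_pow, sub_self]

/-- For any `N`, a principal ideal domain with infinitely many maximal ideals has `N` pairwise
coprime primes together with one further prime. -/
lemma exists_primes [IsPrincipalIdealRing D]
    (hinf : {I : Ideal D | I.IsMaximal}.Infinite) (N : ℕ) :
    ∃ (s : Finset (Ideal D)) (q : Ideal D → D) (r : D), s.card = N ∧ (∀ I ∈ s, Prime (q I)) ∧
      (s : Set (Ideal D)).Pairwise (Function.onFun IsCoprime q) ∧ Prime r ∧
      ∀ I ∈ s, IsCoprime (q I) r := by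
  classical
  obtain ⟨S, hS, hcard⟩ := hinf.exists_subset_card_eq (N + 1)
  obtain ⟨J, hJ⟩ := Finset.card_pos.mp (by omega : 0 < S.card)
  set q : Ideal D → D := fun I => Submodule.IsPrincipal.generator I
  have hspan : ∀ I : Ideal D, Ideal.span {q I} = I := fun I => Ideal.span_singleton_generator I
  have hcop : ∀ I ∈ S, ∀ I' ∈ S, I ≠ I' → IsCoprime (q I) (q I') := fun I hI I' hI' h => by
    rw [← Ideal.isCoprime_span_singleton_iff, hspan, hspan]
    have : I.IsMaximal := hS hI
    have : I'.IsMaximal := hS hI'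
    exact Ideal.isCoprime_of_isMaximal h
  have hbot : ¬ (⊥ : Ideal D).IsMaximal := fun hb => by
    refine hinf (Set.Finite.subset (Set.finite_singleton (⊥ : Ideal D)) fun I hI => ?_)
    exact (hb.eq_of_le hI.ne_top bot_le).symm
  have hprime : ∀ I ∈ S, Prime (q I) := fun I hI => by
    have : I.IsMaximal := hS hI
    exact Submodule.IsPrincipal.prime_generator_of_isPrime I (fun h => hbot (h ▸ this))
  refine ⟨S.erase J, q, q J, by rw [Finset.card_erase_of_mem hJ]; omega,
    fun I hI => hprime I (Finset.mem_of_mem_erase hI), fun I hI I' hI' h => ?_, hprime J hJ,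
    fun I hI => hcop I (Finset.mem_of_mem_erase hI) J hJ (Finset.ne_of_mem_erase hI)⟩
  exact hcop I (Finset.mem_of_mem_erase hI) I' (Finset.mem_of_mem_erase hI') h

variable [IsDomain D]

/-- Evaluation of integer-valued polynomials on `D` at a point, with values in `D`. -/
noncomputable def evalHom (a : D) : IntS D (Set.univ : Set D) →+* D :=
  ((RingEquiv.ofBijective (algebraMap D (FractionRing D)).rangeRestrict
    ⟨fun _ _ h => IsFractionRing.injective D (FractionRing D) (congrArg Subtype.val h),
      RingHom.rangeRestrict_surjective _⟩).symm : _ →+* D).comp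
    (((evalRingHom (algebraMap D (FractionRing D) a)).comp (IntS D Set.univ).subtype).codRestrict
      (algebraMap D (FractionRing D)).range (fun f => f.2 a (Set.mem_univ a)))

lemma algebraMap_evalHom (a : D) (f : IntS D (Set.univ : Set D)) :
    algebraMap D (FractionRing D) (evalHom a f)
      = (f : (FractionRing D)[X]).eval (algebraMap D (FractionRing D) a) := by
  have h := (RingEquiv.ofBijective (algebraMap D (FractionRing D)).rangeRestrict
    ⟨fun _ _ h => IsFractionRing.injective D (FractionRing D) (congrArg Subtype.val h),
      RingHom.rangeRestrict_surjective _⟩).apply_symm_apply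
    ((((evalRingHom (algebraMap D (FractionRing D) a)).comp
      (IntS D Set.univ).subtype).codRestrict
      (algebraMap D (FractionRing D)).range (fun f => f.2 a (Set.mem_univ a))) f)
  exact congrArg Subtype.val h

lemma isUnit_of_natDegree_eq_zero_s4 {f : IntS D (Set.univ : Set D)} {a : D}
    (hf : (f : (FractionRing D)[X]).natDegree = 0) (ha : IsUnit (evalHom a f)) : IsUnit f := by
  obtain ⟨k, hk⟩ := natDegree_eq_zero.mp hf
  have hka : algebraMap D (FractionRing D) (evalHom a f) = k := by
    rw [algebraMap_evalHom, ← hk, eval_C]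
  obtain ⟨e, he⟩ := ha.exists_right_inv
  refine IsUnit.of_mul_eq_one ⟨C (algebraMap D (FractionRing D) e), fun s _ => ⟨e, by simp⟩⟩ ?_
  apply Subtype.ext
  change (f : (FractionRing D)[X]) * C _ = 1
  rw [← hk, ← hka, ← C_mul, ← map_mul, he, map_one, C_1]

lemma natDegree_mul {f g : IntS D (Set.univ : Set D)} (h : f * g ≠ 0) :
    ((f * g : IntS D (Set.univ : Set D)) : (FractionRing D)[X]).natDegree
      = (f : (FractionRing D)[X]).natDegree + (g : (FractionRing D)[X]).natDegree := by
  have hf : (f : (FractionRing D)[X]) ≠ 0 := fun h0 => h (by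
    rw [show f = 0 from Subtype.ext h0, zero_mul])
  have hg : (g : (FractionRing D)[X]) ≠ 0 := fun h0 => h (by
    rw [show g = 0 from Subtype.ext h0, mul_zero])
  exact Polynomial.natDegree_mul hf hg

lemma irreducible_of_natDegree_eq_one {f : IntS D (Set.univ : Set D)} {a : D}
    (hf : (f : (FractionRing D)[X]).natDegree = 1) (ha : IsUnit (evalHom a f)) :
    Irreducible f := by
  have hf0 : f ≠ 0 := by rintro rfl; simp at hf
  refine ⟨fun hu => ?_, fun A B hAB => ?_⟩
  · have := natDegree_eq_zero_of_isUnit (hu.map (IntS D Set.univ).subtype)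
    simp only [Subring.coe_subtype] at this
    omega
  · have hd := natDegree_mul (hAB ▸ hf0)
    rw [← hAB, hf] at hd
    rw [hAB, map_mul, IsUnit.mul_iff] at ha
    rcases Nat.eq_zero_or_pos (A : (FractionRing D)[X]).natDegree with h | h
    · exact Or.inl (isUnit_of_natDegree_eq_zero_s4 h ha.1)
    · exact Or.inr (isUnit_of_natDegree_eq_zero_s4 (by omega) ha.2)

lemma exists_factorization [IsPrincipalIdealRing D] (a : D) (f : IntS D (Set.univ : Set D))
    (hfa : evalHom a f ≠ 0) (hf : ¬ IsUnit f) :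
    ∃ s : Multiset (IntS D (Set.univ : Set D)),
      (∀ b ∈ s, Irreducible b) ∧ s.prod = f ∧ 0 < Multiset.card s := by
  classical
  let _ : StrongNormalizationMonoid D := UniqueFactorizationMonoid.strongNormalizationMonoid
  induction hn : (f : (FractionRing D)[X]).natDegree
    + Multiset.card (UniqueFactorizationMonoid.normalizedFactors (evalHom a f))
    using Nat.strong_induction_on generalizing f with
  | _ n ih =>
  by_cases hirr : Irreducible f
  · exact ⟨{f}, by simpa using hirr, by simp, by simp⟩
  have hpos : ∀ g : IntS D (Set.univ : Set D), evalHom a g ≠ 0 → ¬ IsUnit g →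
      0 < (g : (FractionRing D)[X]).natDegree
        + Multiset.card (UniqueFactorizationMonoid.normalizedFactors (evalHom a g)) := by
    intro g hga hg
    by_contra hc
    have h1 : (g : (FractionRing D)[X]).natDegree = 0 := by omega
    have h2 : UniqueFactorizationMonoid.normalizedFactors (evalHom a g) = 0 :=
      Multiset.card_eq_zero.mp (by omega)
    exact hg (isUnit_of_natDegree_eq_zero_s4 h1
      ((UniqueFactorizationMonoid.normalizedFactors_eq_zero_iff hga).mp h2))
  obtain ⟨A, B, hAB, hA, hB⟩ : ∃ A B, f = A * B ∧ ¬ IsUnit A ∧ ¬ IsUnit B := by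
    by_contra! hc
    exact hirr ⟨hf, fun A B h => or_iff_not_imp_left.mpr (hc A B h)⟩
  subst hAB
  rw [map_mul] at hfa
  have hAa := left_ne_zero_of_mul hfa
  have hBa := right_ne_zero_of_mul hfa
  have hAB0 : A * B ≠ 0 := by
    intro h
    rw [← map_mul, h, map_zero] at hfa
    exact hfa rfl
  rw [natDegree_mul hAB0, map_mul, UniqueFactorizationMonoid.normalizedFactors_mul hAa hBa,
    Multiset.card_add] at hn
  have hpA := hpos A hAa hA
  have hpB := hpos B hBa hB
  obtain ⟨s, hs, hsA, hsc⟩ := ih _ (by omega) A hAa hA rfl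
  obtain ⟨t, ht, htB, -⟩ := ih _ (by omega) B hBa hB rfl
  refine ⟨s + t, fun b hb => ?_, by rw [Multiset.prod_add, hsA, htB], by
    rw [Multiset.card_add]; omega⟩
  exact (Multiset.mem_add.mp hb).elim (hs b) (ht b)

/-- A polynomial with coefficients in `D`, viewed as an integer-valued polynomial. -/
noncomputable def ofPoly : D[X] →+* IntS D (Set.univ : Set D) :=
  (mapRingHom (algebraMap D (FractionRing D))).codRestrict (IntS D Set.univ)
    (fun f s _ => ⟨f.eval s, (eval_map_apply _ s).symm⟩)

lemma coe_ofPoly (f : D[X]) :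
    (ofPoly f : (FractionRing D)[X]) = f.map (algebraMap D (FractionRing D)) := rfl

@[simp]
lemma evalHom_ofPoly (a : D) (f : D[X]) : evalHom a (ofPoly f) = f.eval a := by
  apply IsFractionRing.injective D (FractionRing D)
  rw [algebraMap_evalHom, coe_ofPoly, eval_map_apply]

lemma ofPoly_injective : Function.Injective (ofPoly (D := D)) := fun _ _ h =>
  map_injective _ (IsFractionRing.injective D (FractionRing D)) (congrArg Subtype.val h)

lemma map_mul_coe_eq {f h : D[X]} {g : IntS D (Set.univ : Set D)} (H : ofPoly f * g = ofPoly h) :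
    f.map (algebraMap D (FractionRing D)) * (g : (FractionRing D)[X])
      = h.map (algebraMap D (FractionRing D)) :=
  congrArg Subtype.val H

/-- If `d` is nonzero and divides all values of `f`, then `f / d` is integer-valued. -/
lemma exists_C_mul_eq {d : D} (hd : d ≠ 0) (f : D[X]) (h : ∀ a, d ∣ f.eval a) :
    ∃ g : IntS D (Set.univ : Set D), ofPoly (C d) * g = ofPoly f := by
  have hd' : algebraMap D (FractionRing D) d ≠ 0 := by simpa using hd
  refine ⟨⟨C (algebraMap D (FractionRing D) d)⁻¹ * f.map (algebraMap D (FractionRing D)),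
    fun a _ => ?_⟩, ?_⟩
  · obtain ⟨e, he⟩ := h a
    refine ⟨e, ?_⟩
    rw [eval_mul, eval_C, eval_map_apply, he, map_mul, inv_mul_cancel_left₀ hd']
  · apply Subtype.ext
    change (ofPoly (C d) : (FractionRing D)[X]) * (C _ * _) = _
    rw [coe_ofPoly, map_C, ← mul_assoc, ← C_mul, mul_inv_cancel₀ hd', C_1, one_mul]
    rfl

lemma isUnit_right_of_dvd {ι : Type*} [DecidableEq ι] {t u : Finset ι} {q : ι → D}
    (hq : ∀ i ∈ t ∪ u, Prime (q i)) (htu : Disjoint t u) {g : D[X]}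
    (hg : g ≠ 0)
    (hcop : ∀ i ∈ t ∪ u, IsCoprime (q i) (g.eval 0)) {A B : IntS D (Set.univ : Set D)}
    (h01 : IsCoprime (evalHom 0 (A * B)) (evalHom 1 (A * B)))
    {b c : (FractionRing D)[X]}
    (hbc : C (algebraMap D (FractionRing D) (∏ i ∈ t ∪ u, q i))⁻¹
      * g.map (algebraMap D (FractionRing D)) = b * c)
    (hA : (A : (FractionRing D)[X])
      = b * ∏ i ∈ t, (lin (q i)).map (algebraMap D (FractionRing D)))
    (hB : (B : (FractionRing D)[X])
      = c * ∏ i ∈ u, (lin (q i)).map (algebraMap D (FractionRing D)))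
    (hgb : g.map (algebraMap D (FractionRing D)) ∣ b) : IsUnit B := by
  set φ := algebraMap D (FractionRing D) with hφ
  have hinj : Function.Injective φ := IsFractionRing.injective D (FractionRing D)
  set Q := ∏ i ∈ t ∪ u, q i with hQ
  have hQ0 : Q ≠ 0 := Finset.prod_ne_zero_iff.mpr fun i hi => (hq i hi).ne_zero
  have hφQ : φ Q ≠ 0 := by rwa [Ne, map_eq_zero_iff φ hinj]
  obtain ⟨b', rfl⟩ := hgb
  have hgK : g.map φ ≠ 0 := (Polynomial.map_ne_zero_iff hinj).mpr hg
  have hb'c : b' * c = C (φ Q)⁻¹ := mul_left_cancel₀ hgK (by rw [← mul_assoc, ← hbc, mul_comm])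
  have hcu : IsUnit c := isUnit_of_mul_isUnit_right
    (hb'c ▸ isUnit_C.mpr (isUnit_iff_ne_zero.mpr (inv_ne_zero hφQ)))
  obtain ⟨k, hk⟩ := natDegree_eq_zero.mp (natDegree_eq_zero_of_isUnit hcu)
  have hkB : φ (evalHom 1 B) = k := by
    rw [algebraMap_evalHom, hB, ← hk, eval_mul, eval_C, eval_prod]
    simp only [← hφ, eval_map_apply, eval_lin]
    simp
  have hA0 : φ (evalHom 0 A) = φ (g.eval 0) * b'.eval 0 * φ (∏ i ∈ t, q i) := by
    rw [algebraMap_evalHom, hA, eval_mul, eval_mul, eval_prod, ← hφ, eval_map_apply, map_prod]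
    simp only [eval_map_apply, eval_lin]
    simp
  have hb'0 : b'.eval 0 * k = (φ Q)⁻¹ := by
    simpa [← hk] using congrArg (eval 0) hb'c
  have hdvd : Q ∣ g.eval 0 * ∏ i ∈ t, q i := by
    refine ⟨evalHom 1 B * evalHom 0 A, hinj ?_⟩
    rw [map_mul, map_mul, map_mul, hkB, hA0]
    have : φ Q * (b'.eval 0 * k) = 1 := by rw [hb'0, mul_inv_cancel₀ hφQ]
    linear_combination (-φ (eval 0 g) * φ (∏ i ∈ t, q i)) * this
  have hdvd' : Q ∣ ∏ i ∈ t, q i :=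
    (IsCoprime.prod_left fun i hi => hcop i hi).dvd_of_dvd_mul_left hdvd
  have hu1 : ∏ i ∈ u, q i ∣ 1 := by
    have ht0 : ∏ i ∈ t, q i ≠ 0 := Finset.prod_ne_zero_iff.mpr fun i hi =>
      (hq i (Finset.mem_union_left _ hi)).ne_zero
    rw [hQ, Finset.prod_union htu] at hdvd'
    exact (mul_dvd_mul_iff_left ht0).mp (by rwa [mul_one])
  have hu : u = ∅ := Finset.eq_empty_of_forall_notMem fun i hi =>
    (hq i (Finset.mem_union_right _ hi)).not_isUnit
      (isUnit_of_dvd_one ((Finset.dvd_prod_of_mem q hi).trans hu1))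
  subst hu
  rw [Finset.prod_empty, mul_one, ← hk] at hB
  have hB0 : evalHom 0 B = evalHom 1 B := hinj (by
    rw [hkB, algebraMap_evalHom, hB, eval_C])
  refine isUnit_of_natDegree_eq_zero_s4 (a := 1) (by rw [hB, natDegree_C]) ?_
  refine h01.isUnit_of_dvd' ?_ ?_
  · rw [map_mul, hB0]; exact dvd_mul_left _ _
  · rw [map_mul]; exact dvd_mul_left _ _

lemma irreducible_of_mul_eq {ι : Type*} [DecidableEq ι] {s : Finset ι} {q : ι → D}
    (hq : ∀ i ∈ s, Prime (q i)) {g : D[X]}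
    (hg : Irreducible (g.map (algebraMap D (FractionRing D))))
    (hcop : ∀ i ∈ s, IsCoprime (q i) (g.eval 0)) {H : IntS D (Set.univ : Set D)}
    (hH : ofPoly (C (∏ i ∈ s, q i)) * H = ofPoly (g * ∏ i ∈ s, lin (q i)))
    (h01 : IsCoprime (evalHom 0 H) (evalHom 1 H)) : Irreducible H := by
  set φ := algebraMap D (FractionRing D) with hφ
  have hinj : Function.Injective φ := IsFractionRing.injective D (FractionRing D)
  have hφQ : φ (∏ i ∈ s, q i) ≠ 0 := by
    rw [Ne, map_eq_zero_iff φ hinj]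
    exact Finset.prod_ne_zero_iff.mpr fun i hi => (hq i hi).ne_zero
  have hg0 : g ≠ 0 := by rintro rfl; simp at hg
  have hHK : (H : (FractionRing D)[X])
      = (C (φ (∏ i ∈ s, q i))⁻¹ * g.map φ) * ∏ i ∈ s, (lin (q i)).map φ := by
    have h := map_mul_coe_eq hH
    rw [map_C, Polynomial.map_mul, Polynomial.map_prod] at h
    rw [mul_assoc, ← h, ← mul_assoc, ← C_mul, inv_mul_cancel₀ hφQ, C_1, one_mul]
  have hlin : ∀ i ∈ s, Prime ((lin (q i)).map φ) := fun i hi =>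
    (irreducible_of_degree_eq_one (degree_eq_iff_natDegree_eq_of_pos one_pos |>.mpr
      (natDegree_map_lin (hq i hi).ne_one))).prime
  refine ⟨fun hu => ?_, fun A B hAB => ?_⟩
  · have hK := hu.map (IntS D Set.univ).subtype
    rw [Subring.coe_subtype, hHK] at hK
    exact hg.not_isUnit (isUnit_of_mul_isUnit_right (isUnit_of_mul_isUnit_left hK))
  · subst hAB
    obtain ⟨t, u, b, c, rfl, htu, hbc, hA, hB⟩ :=
      mul_eq_mul_prime_prod hlin (x := (A : (FractionRing D)[X])) (y := B) hHK
    have hdvd : g.map φ ∣ b * c := hbc ▸ dvd_mul_left _ _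
    rcases hg.prime.dvd_or_dvd hdvd with h | h
    · exact Or.inr (isUnit_right_of_dvd hq htu hg0 hcop h01 hbc hA hB h)
    · refine Or.inl (isUnit_right_of_dvd (t := u) (u := t) (q := q) (A := B) (B := A)
        (b := c) (c := b) ?_ htu.symm hg0 ?_ ?_ ?_ hB hA h)
      · rwa [Finset.union_comm]
      · rwa [Finset.union_comm]
      · rwa [mul_comm]
      · rwa [Finset.union_comm, mul_comm c]

/-- For a prime `r` coprime to `Q` there is an element that is `1` modulo `Q` and divisible by `r`
exactly once. -/
lemma exists_dvd_one_sub {Q r : D} (hr : Prime r) (hQr : IsCoprime Q r) :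
    ∃ c : D, Q ∣ 1 - c ∧ r ∣ c ∧ ¬ r ^ 2 ∣ c := by
  obtain ⟨a, b, hab⟩ := hQr.pow_right (n := 2)
  refine ⟨b * r ^ 2 + r * (a * Q), ⟨a - r * a, by linear_combination hab.symm⟩,
    ⟨b * r + a * Q, by ring⟩, fun h => ?_⟩
  have h1 : r ^ 2 ∣ r := by
    obtain ⟨k, hk⟩ := h
    exact ⟨k - b + r * b, by linear_combination r * hab.symm + hk⟩
  have h2 : r * r ∣ r * 1 := by rwa [mul_one, ← sq]
  exact hr.not_isUnit (isUnit_of_dvd_one ((mul_dvd_mul_iff_left hr.ne_zero).mp h2))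

lemma irreducible_map_X_pow_sub_C [IsIntegrallyClosed D] {r c : D} (hr : Prime r) (hrc : r ∣ c)
    (hrc2 : ¬ r ^ 2 ∣ c) {m : ℕ} (hm : 0 < m) :
    Irreducible ((X ^ m - C c : D[X]).map (algebraMap D (FractionRing D))) := by
  have hmonic : (X ^ m - C c : D[X]).Monic := monic_X_pow_sub_C c hm.ne'
  refine hmonic.irreducible_iff_irreducible_map_fraction_map.mp ?_
  have hP : (Ideal.span {r}).IsPrime := (Ideal.span_singleton_prime hr.ne_zero).mpr hr
  refine irreducible_of_eisenstein_criterion hP ?_ ?_ ?_ ?_ hmonic.isPrimitive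
  · rw [hmonic.leadingCoeff]
    exact fun h => hP.ne_top ((Ideal.eq_top_iff_one _).mpr h)
  · intro n hn
    rw [degree_X_pow_sub_C hm, Nat.cast_lt] at hn
    rw [coeff_sub, coeff_X_pow, if_neg hn.ne, zero_sub, neg_mem_iff, coeff_C]
    split_ifs
    · exact Ideal.mem_span_singleton.mpr hrc
    · exact zero_mem _
  · rw [degree_X_pow_sub_C hm]
    exact_mod_cast hm
  · rw [coeff_sub, coeff_X_pow, if_neg hm.ne, zero_sub, neg_mem_iff, coeff_C_zero,
      Ideal.span_singleton_pow, Ideal.mem_span_singleton]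
    exact hrc2

/-- From finitely many pairwise coprime primes `q i` with finite residue rings and one further prime
one gets an irreducible `H` such that `X * H` has a factorization with more irreducible factors
than there are primes `q i`. -/
theorem exists_irreducible_of_primes [IsPrincipalIdealRing D] {ι : Type*} [DecidableEq ι]
    {s : Finset ι} {q : ι → D} (hq : ∀ i ∈ s, Prime (q i))
    (hfin : ∀ i ∈ s, Finite (D ⧸ Ideal.span {q i}))
    (hcop : (s : Set ι).Pairwise (Function.onFun IsCoprime q)) {r : D} (hr : Prime r)
    (hqr : ∀ i ∈ s, IsCoprime (q i) r) :
    ∃ H : IntS D (Set.univ : Set D), Irreducible H ∧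
      ∃ f : Multiset (IntS D (Set.univ : Set D)),
        (∀ a ∈ f, Irreducible a) ∧ f.prod = ofPoly X * H ∧ s.card < Multiset.card f := by
  obtain ⟨c, hQc, hrc, hrc2⟩ := exists_dvd_one_sub hr (IsCoprime.prod_left hqr)
  set Q := ∏ i ∈ s, q i with hQ
  have hQ0 : Q ≠ 0 := Finset.prod_ne_zero_iff.mpr fun i hi => (hq i hi).ne_zero
  have hqc : ∀ i ∈ s, q i ∣ 1 - c := fun i hi => (Finset.dvd_prod_of_mem q hi).trans hQc
  set m := ∏ i ∈ s, Nat.card (D ⧸ Ideal.span {q i})ˣ with hm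
  have hm0 : 0 < m := Finset.prod_pos fun i hi => by
    have := hfin i hi
    exact Nat.card_pos
  set g : D[X] := X ^ m - C c with hg
  have hg0 : g.eval 0 = -c := by simp [hg, hm0.ne']
  have hg1 : g.eval 1 = 1 - c := by simp [hg]
  have hgirr := irreducible_map_X_pow_sub_C hr hrc hrc2 hm0
  have hqg : ∀ i ∈ s, ∀ a, q i ∣ a * g.eval a := fun i hi a => by
    have hmax : (Ideal.span {q i}).IsMaximal :=
      PrincipalIdealRing.isMaximal_of_irreducible (hq i hi).irreducible
    simpa [hg] using dvd_mul_pow_sub hmax (hqc i hi)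
      (Finset.dvd_prod_of_mem (fun i => Nat.card (D ⧸ Ideal.span {q i})ˣ) hi) a
  obtain ⟨H, hH⟩ := exists_C_mul_eq hQ0 (g * ∏ i ∈ s, lin (q i)) fun a => by
    refine Finset.prod_dvd_of_coprime hcop fun i hi => ?_
    rw [eval_mul, eval_prod]
    rcases (hq i hi).dvd_or_dvd (hqg i hi a) with h | h
    · refine ((dvd_add (h.mul_left (1 - q i)) dvd_rfl).trans ?_).mul_left _
      rw [← eval_lin]
      exact Finset.dvd_prod_of_mem (fun i => (lin (q i)).eval a) hi
    · exact h.mul_right _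
  obtain ⟨G, hG⟩ := exists_C_mul_eq hQ0 (X * g) fun a =>
    Finset.prod_dvd_of_coprime hcop fun i hi => by simpa using hqg i hi a
  have hH0 : evalHom 0 H = -c := by
    have h := congrArg (evalHom 0) hH
    simp only [map_mul, evalHom_ofPoly, eval_C, eval_prod, eval_lin, hg0, mul_zero,
      zero_add, ← hQ] at h
    exact mul_left_cancel₀ hQ0 (by rw [h, mul_comm])
  have hH1 : Q * evalHom 1 H = 1 - c := by
    simpa [eval_prod, hg1] using congrArg (evalHom 1) hH
  have hG1 : Q * evalHom 1 G = 1 - c := by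
    simpa [hg1] using congrArg (evalHom 1) hG
  have hirr : Irreducible H := by
    refine irreducible_of_mul_eq hq hgirr (fun i hi => ?_) hH ?_
    · obtain ⟨k, hk⟩ := hqc i hi
      rw [hg0]
      exact ⟨k, -1, by linear_combination hk.symm⟩
    · exact ⟨-1, Q, by rw [hH0, hH1]; ring⟩
  have hG1' : evalHom 1 G ≠ 0 := fun h => by
    rw [h, mul_zero] at hG1
    exact hr.not_isUnit (isUnit_of_dvd_one (sub_eq_zero.mp hG1.symm ▸ hrc))
  have hGu : ¬ IsUnit G := fun hu => by
    have h := (hu.map (IntS D Set.univ).subtype)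
    have hu' := congrArg (eval 0) (map_mul_coe_eq hG)
    obtain ⟨k, hk⟩ := natDegree_eq_zero.mp (natDegree_eq_zero_of_isUnit h)
    rw [Subring.coe_subtype] at hk
    rw [← hk] at hu'
    simp [hQ0] at hu'
    rw [hu', C_0] at hk
    exact hG1' (by rw [show G = 0 from Subtype.ext hk.symm, map_zero])
  obtain ⟨f, hf, hfG, hfc⟩ := exists_factorization 1 G hG1' hGu
  refine ⟨H, hirr, f + s.val.map (fun i => ofPoly (lin (q i))), fun a ha => ?_, ?_, ?_⟩
  · rcases Multiset.mem_add.mp ha with ha | ha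
    · exact hf a ha
    · obtain ⟨i, hi, rfl⟩ := Multiset.mem_map.mp ha
      exact irreducible_of_natDegree_eq_one (a := 1) (natDegree_map_lin (hq i hi).ne_one)
        (by simp)
  · rw [Multiset.prod_add, hfG]
    change G * ∏ i ∈ s, ofPoly (lin (q i)) = _
    have hCQ : ofPoly (C Q) ≠ 0 := by
      rw [← map_zero (ofPoly (D := D)), ofPoly_injective.ne_iff]
      exact C_ne_zero.mpr hQ0
    refine mul_left_cancel₀ hCQ ?_
    rw [← mul_assoc, hG, mul_left_comm, hH, map_mul, map_mul, map_prod, mul_assoc]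
  · rw [Multiset.card_add, Multiset.card_map, Finset.card_val]
    omega

/-- The substitution `x ↦ x / p` identifies `Int(D)` with `Int((p), D)`. -/
lemma exists_ringEquiv_span {p : D} (hp : p ≠ 0) :
    ∃ e : IntS D (Set.univ : Set D) ≃+* IntS D ((Ideal.span {p} : Ideal D) : Set D),
      (e (ofPoly X) : (FractionRing D)[X]) = C (algebraMap D (FractionRing D) p)⁻¹ * X := by
  set k := algebraMap D (FractionRing D) p with hk
  have hk0 : k ≠ 0 := by simpa [hk] using hp
  let E : (FractionRing D)[X] ≃ₐ[FractionRing D] (FractionRing D)[X] :=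
    algEquivOfCompEqX (C k⁻¹ * X) (C k * X)
      (by simp [← mul_assoc, ← C_mul, hk0]) (by simp [← mul_assoc, ← C_mul, hk0])
  have hE : ∀ f, E f = f.comp (C k⁻¹ * X) := fun f => rfl
  refine ⟨E.toRingEquiv.restrict _ _ ?_, ?_⟩
  · intro f
    have hEf : ∀ a : D, (E f).eval (algebraMap D (FractionRing D) (p * a))
        = f.eval (algebraMap D (FractionRing D) a) := fun a => by
      rw [hE, eval_comp, eval_mul, eval_C, eval_X, map_mul, ← hk, inv_mul_cancel_left₀ hk0]
    constructor
    · intro hf s hs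
      obtain ⟨a, rfl⟩ := Ideal.mem_span_singleton.mp hs
      change (E f).eval _ ∈ _
      rw [hEf]
      exact hf a (Set.mem_univ a)
    · intro hf a _
      rw [← hEf]
      exact hf (p * a) (Ideal.mem_span_singleton.mpr (dvd_mul_right p a))
  · change E (X.map _) = _
    rw [hE, map_X, X_comp]

end IntS

/-- **Theorem (unbounded lengths of products with a fixed irreducible).** Let `D` be
a PID with infinitely many maximal ideals such that every nonzero prime ideal has
finite residue ring. Let `p` be a prime element of `D` and `M = (p)`. Then there is
an irreducible element `u = x/p` of `Int(M,D)` such that for every `N` there exists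
an irreducible `H ∈ Int(M,D)` for which `u * H` admits a factorization into more
than `N` irreducible elements of `Int(M,D)`. -/
theorem unbounded_factorization_lengths_of_products
    (D : Type*) [CommRing D] [IsDomain D] [IsPrincipalIdealRing D]
    (hinf : {I : Ideal D | I.IsMaximal}.Infinite)
    (hfin : ∀ I : Ideal D, I ≠ ⊥ → I.IsPrime → Finite (D ⧸ I))
    (p : D) (hp : Prime p) :
    ∃ u : IntS D ((Ideal.span {p} : Ideal D) : Set D),
      (u : Polynomial (FractionRing D))
        = C ((algebraMap D (FractionRing D) p)⁻¹) * X ∧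
      Irreducible u ∧
      ∀ N : ℕ, ∃ H : IntS D ((Ideal.span {p} : Ideal D) : Set D),
        Irreducible H ∧
        ∃ s : Multiset (IntS D ((Ideal.span {p} : Ideal D) : Set D)),
          (∀ a ∈ s, Irreducible a) ∧ s.prod = u * H ∧ N < Multiset.card s := by
  classical
  obtain ⟨e, he⟩ := IntS.exists_ringEquiv_span hp.ne_zero
  refine ⟨e (IntS.ofPoly X), he, ?_, fun N => ?_⟩
  · exact (MulEquiv.irreducible_iff e).mpr (IntS.irreducible_of_natDegree_eq_one (a := 1)
      (by rw [IntS.coe_ofPoly, map_X, natDegree_X]) (by simp))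
  · obtain ⟨s, q, r, hs, hq, hcop, hr, hqr⟩ := IntS.exists_primes hinf N
    obtain ⟨H, hH, f, hf, hfH, hfc⟩ := IntS.exists_irreducible_of_primes hq
      (fun I hI => hfin _ (by simpa using (hq I hI).ne_zero)
        ((Ideal.span_singleton_prime (hq I hI).ne_zero).mpr (hq I hI))) hcop hr hqr
    refine ⟨e H, (MulEquiv.irreducible_iff e).mpr hH, f.map e, fun a ha => ?_, ?_, ?_⟩
    · obtain ⟨b, hb, rfl⟩ := Multiset.mem_map.mp ha
      exact (MulEquiv.irreducible_iff e).mpr (hf b hb)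
    · rw [← map_mul, ← hfH, map_multiset_prod]
    · rw [Multiset.card_map]
      omega
end

section
/- Let D be a principal ideal domain and M a maximal ideal of D. Then for each natural number q, there are at most finitely many maximal ideals (p) of D (equivalently, finitely many pairwise non-associate prime elements p of D) such that the image of M under the quotient map D → D/pD has exactly q elements. -/
/-- A nonzero ideal of a Dedekind domain is contained in only finitely many ideals. -/
theorem Ideal.finite_setOf_le_of_ne_bot {D : Type*} [CommRing D] [IsDedekindDomain D]
    {J : Ideal D} (hJ : J ≠ ⊥) : {I : Ideal D | J ≤ I}.Finite := by
  have := UniqueFactorizationMonoid.fintypeSubtypeDvd J hJ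
  exact (Set.finite_range (Subtype.val : {I : Ideal D // I ∣ J} → Ideal D)).subset
    fun I hI => ⟨⟨I, Ideal.dvd_iff_le.mpr hI⟩, rfl⟩

/-- A Dedekind domain has only finitely many maximal ideals of a given finite index. -/
theorem Ideal.finite_setOf_isMaximal_natCard_quotient_eq (D : Type*) [CommRing D]
    [IsDedekindDomain D] (q : ℕ) :
    {I : Ideal D | I.IsMaximal ∧ Finite (D ⧸ I) ∧ Nat.card (D ⧸ I) = q}.Finite := by
  rcases finite_or_infinite D with hD | hD
  · exact Set.toFinite _
  rcases le_or_gt q 1 with hq | hq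
  · refine Set.Finite.subset Set.finite_empty fun I ⟨hI, hfin, hcard⟩ => ?_
    have := Ideal.Quotient.nontrivial_iff.mpr hI.ne_top
    have := Finite.one_lt_card (α := D ⧸ I)
    omega
  obtain ⟨x, hx⟩ : ∃ x : D, x ^ q - x ≠ 0 := by
    by_contra! h
    have hpoly : (Polynomial.X ^ q - Polynomial.X : Polynomial D) = 0 :=
      Polynomial.funext fun x => by simpa using h x
    simpa [Polynomial.coeff_X_pow, hq.ne] using congrArg (fun f => f.coeff 1) hpoly
  refine (Ideal.finite_setOf_le_of_ne_bot (J := Ideal.span {x ^ q - x})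
    (by simpa using hx)).subset fun I ⟨hI, hfin, hcard⟩ => ?_
  let := Ideal.Quotient.field I
  have := Fintype.ofFinite (D ⧸ I)
  rw [Nat.card_eq_fintype_card] at hcard
  rw [Set.mem_ofPred_eq, Ideal.span_singleton_le_iff_mem, ← Ideal.Quotient.eq_zero_iff_mem,
    map_sub, map_pow, ← hcard, FiniteField.pow_card, sub_self]

/-- The image of a maximal ideal in the quotient by a different maximal ideal is everything. -/
theorem Ideal.Quotient.image_mk_eq_univ_of_isMaximal_of_ne {D : Type*} [CommRing D]
    {I M : Ideal D} (hI : I.IsMaximal) (hM : M.IsMaximal) (hne : I ≠ M) :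
    Ideal.Quotient.mk I '' (M : Set D) = Set.univ := by
  refine Set.eq_univ_of_forall fun y => ?_
  obtain ⟨x, rfl⟩ := Ideal.Quotient.mk_surjective y
  have hx : x ∈ I ⊔ M := by
    rw [hI.coprime_of_ne hM hne]
    trivial
  obtain ⟨i, hi, m, hm, rfl⟩ := Submodule.mem_sup.mp hx
  exact ⟨m, hm, by simp [Ideal.Quotient.eq_zero_iff_mem.mpr hi]⟩

/-- **Lemma.** Let `D` be a PID and `M` a maximal ideal of `D`. For each `q : ℕ`,
there are at most finitely many maximal ideals `I = (p)` of `D` such that the image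
of `M` under the quotient map `D → D/I` has exactly `q` elements. -/
theorem finitely_many_maximal_ideals_with_given_residue_count
    (D : Type*) [CommRing D] [IsDomain D] [IsPrincipalIdealRing D]
    (M : Ideal D) (hM : M.IsMaximal) (q : ℕ) :
    {I : Ideal D | I.IsMaximal ∧
      (Ideal.Quotient.mk I '' (M : Set D)).Finite ∧
      (Ideal.Quotient.mk I '' (M : Set D)).ncard = q}.Finite := by
  refine ((Ideal.finite_setOf_isMaximal_natCard_quotient_eq D q).insert M).subset
    fun I ⟨hI, hfin, hcard⟩ => ?_
  by_cases hne : I = M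
  · exact Or.inl hne
  rw [Ideal.Quotient.image_mk_eq_univ_of_isMaximal_of_ne hI hM hne] at hfin hcard
  exact Or.inr ⟨hI, Set.finite_univ_iff.mp hfin, by rwa [Set.ncard_univ] at hcard⟩
end

section
/- Let D be a principal ideal domain with infinitely many maximal ideals such that for every nonzero prime ideal M' of D the residue ring D/M' is finite, and let M be a maximal ideal of D. Then for every natural number n, there exist infinitely many pairwise non-associate prime elements p of D such that the image of M under the quotient map D → D/pD has more than n elements. -/
/-- A nonzero element of a Dedekind domain lies in only finitely many nonzero maximal ideals. -/
theorem finite_setOf_isMaximal_mem {D : Type*} [CommRing D] [IsDedekindDomain D] {d : D}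
    (hd : d ≠ 0) : {I : Ideal D | I.IsMaximal ∧ I ≠ ⊥ ∧ d ∈ I}.Finite := by
  have hne : Ideal.span {d} ≠ ⊥ := by simpa using hd
  refine ((Ideal.finite_factors hne).image IsDedekindDomain.HeightOneSpectrum.asIdeal).subset ?_
  rintro I ⟨hI, hbot, hdI⟩
  exact ⟨⟨I, hI.isPrime, hbot⟩,
    Ideal.dvd_iff_le.2 ((Ideal.span_singleton_le_iff_mem I).2 hdI), rfl⟩

/-- In a domain with infinitely many maximal ideals, maximal ideals are nonzero. -/
theorem Ideal.IsMaximal.ne_bot_of_infinite_isMaximal {D : Type*} [CommRing D]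
    (hinf : {I : Ideal D | I.IsMaximal}.Infinite) {M : Ideal D} (hM : M.IsMaximal) : M ≠ ⊥ := by
  rintro rfl
  refine hinf ((Set.finite_singleton (⊥ : Ideal D)).subset fun I hI => ?_)
  exact (hM.eq_of_le (Ideal.IsMaximal.ne_top hI) bot_le).symm

/-- A nonzero ideal of an infinite domain is infinite. -/
theorem Ideal.infinite_coe_of_ne_bot {D : Type*} [CommRing D] [IsDomain D] [Infinite D]
    {M : Ideal D} (hM : M ≠ ⊥) : (M : Set D).Infinite := by
  obtain ⟨m, hm, hm0⟩ := Submodule.exists_mem_ne_zero_of_ne_bot hM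
  refine (Set.infinite_range_of_injective (mul_right_injective₀ hm0)).mono ?_
  rintro _ ⟨x, rfl⟩
  exact M.mul_mem_right x hm

/-- **Lemma.** Let `D` be a PID with infinitely many maximal ideals such that every
nonzero prime ideal has finite residue ring, and let `M` be a maximal ideal of `D`.
Then for every `n : ℕ` there exist infinitely many pairwise non-associate prime
elements `p` of `D` such that the image of `M` under the quotient map `D → D/pD`
has more than `n` elements. -/
theorem infinitely_many_primes_with_large_residue_sets
    (D : Type*) [CommRing D] [IsDomain D] [IsPrincipalIdealRing D]
    (hinf : {I : Ideal D | I.IsMaximal}.Infinite)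
    (hfin : ∀ I : Ideal D, I ≠ ⊥ → I.IsPrime → Finite (D ⧸ I))
    (M : Ideal D) (hM : M.IsMaximal) (n : ℕ) :
    ∃ P : Set D, P.Infinite ∧ (∀ p ∈ P, Prime p) ∧
      (P.Pairwise fun p p' => ¬ Associated p p') ∧
      ∀ p ∈ P,
        n < (Ideal.Quotient.mk (Ideal.span {p}) '' (M : Set D)).ncard := by
  classical
  have : Infinite D := by
    by_contra h
    have : Finite D := not_infinite_iff_finite.1 h
    have : Finite (Ideal D) := Finite.of_injective _ (SetLike.coe_injective (A := Ideal D))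
    exact hinf (Set.toFinite _)
  have hbot {I : Ideal D} (hI : I.IsMaximal) : I ≠ ⊥ := hI.ne_bot_of_infinite_isMaximal hinf
  obtain ⟨S, hSM, hScard⟩ :=
    (Ideal.infinite_coe_of_ne_bot (hbot hM)).exists_subset_card_eq (n + 1)
  let d : D := ∏ x ∈ S.offDiag, (x.1 - x.2)
  have hd0 : d ≠ 0 := Finset.prod_ne_zero_iff.2 fun x hx =>
    sub_ne_zero.2 (Finset.mem_offDiag.1 hx).2.2
  let T : Set (Ideal D) := {I | I.IsMaximal} \ {I | I.IsMaximal ∧ I ≠ ⊥ ∧ d ∈ I}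
  have hT : T.Infinite := hinf.sdiff (finite_setOf_isMaximal_mem hd0)
  let g : Ideal D → D := fun I => Submodule.IsPrincipal.generator I
  have hg (I : Ideal D) : Ideal.span {g I} = I := Ideal.span_singleton_generator I
  have hginj : Function.Injective g :=
    Function.LeftInverse.injective (g := fun x => Ideal.span {x}) hg
  refine ⟨g '' T, hT.image hginj.injOn, ?_, ?_, ?_⟩
  · rintro _ ⟨I, ⟨hI, -⟩, rfl⟩
    have := Ideal.IsMaximal.isPrime hI
    exact Submodule.IsPrincipal.prime_generator_of_isPrime I (hbot hI)
  · rintro _ ⟨I, -, rfl⟩ _ ⟨J, -, rfl⟩ hne hassoc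
    refine hne (congrArg g ?_)
    rw [← hg I, ← hg J]
    exact Ideal.span_singleton_eq_span_singleton.2 hassoc
  · rintro _ ⟨I, ⟨hI, hdI⟩, rfl⟩
    rw [hg I]
    have hdI' : d ∉ I := fun h => hdI ⟨hI, hbot hI, h⟩
    have := hfin I (hbot hI) (Ideal.IsMaximal.isPrime hI)
    have hinj : Set.InjOn (Ideal.Quotient.mk I) (S : Set D) := by
      intro x hx y hy hxy
      by_contra hne
      refine hdI' (I.mem_of_dvd (Finset.dvd_prod_of_mem (fun x : D × D => x.1 - x.2)
        (Finset.mem_offDiag.2 ⟨hx, hy, hne⟩ : (x, y) ∈ S.offDiag)) (Ideal.Quotient.eq.1 hxy))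
    calc n < (S : Set D).ncard := by rw [Set.ncard_coe_finset, hScard]; exact n.lt_succ_self
      _ = (Ideal.Quotient.mk I '' (S : Set D)).ncard := hinj.ncard_image.symm
      _ ≤ _ := Set.ncard_le_ncard (Set.image_mono hSM) (Set.toFinite _)
end

section
/- Let D be a principal ideal domain and S an infinite subset of D. Let f be a nonconstant primitive polynomial in D[x], and let d ∈ D be a fixed divisor of f over S, i.e., a generator of the (principal) ideal of D generated by {f(s) : s ∈ S} (note d ≠ 0 since S is infinite and f is nonconstant). Then f/d is irreducible in Int(S,D) if and only if either f is irreducible in D[x], or for every pair of nonconstant polynomials f_1, f_2 ∈ D[x] with f = f_1 f_2, d does not divide d_1 · d_2, where d_1, d_2 are fixed divisors of f_1, f_2 over S respectively. -/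
open Polynomial

/-- Primitive polynomials that agree up to constants agree up to a unit. -/
theorem Polynomial.IsPrimitive.exists_unit_of_C_mul_eq {D : Type*} [CommRing D] [IsDomain D]
    [IsPrincipalIdealRing D] {f h : D[X]} (hf : f.IsPrimitive) (hh : h.IsPrimitive) {x y : D}
    (hx : x ≠ 0) (e : C x * f = C y * h) : ∃ u : Dˣ, y = x * u ∧ f = C (u : D) * h := by
  classical
  obtain ⟨inst⟩ : Nonempty (NormalizedGCDMonoid D) := inferInstance
  have hc : Associated x y := by
    have h₁ := associated_content_C_mul x f
    have h₂ := associated_content_C_mul y h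
    rw [hf.content_eq_one, mul_one] at h₁
    rw [hh.content_eq_one, mul_one] at h₂
    exact h₁.symm.trans (e ▸ h₂)
  obtain ⟨u, rfl⟩ := hc
  refine ⟨u, rfl, ?_⟩
  rw [C_mul, mul_assoc] at e
  exact mul_left_cancel₀ (C_ne_zero.mpr hx) e

/-- A polynomial over the fraction field is a reduced fraction times a primitive
polynomial. -/
theorem Polynomial.exists_reduced_isPrimitive {D : Type*} [CommRing D] [IsDomain D]
    [IsPrincipalIdealRing D] (a : (FractionRing D)[X]) :
    ∃ (A : D[X]) (p q : D), A.IsPrimitive ∧ q ≠ 0 ∧ IsRelPrime p q ∧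
      C (algebraMap D (FractionRing D) q) * a =
        C (algebraMap D (FractionRing D) p) * A.map (algebraMap D (FractionRing D)) := by
  classical
  obtain ⟨inst⟩ : Nonempty (NormalizedGCDMonoid D) := inferInstance
  obtain ⟨b, hb, hba⟩ := IsLocalization.integerNormalization_spec (nonZeroDivisors D) a
  have hb0 : algebraMap D (FractionRing D) b ≠ 0 := by
    simpa using nonZeroDivisors.ne_zero hb
  set N := IsLocalization.integerNormalization (nonZeroDivisors D) a
  obtain ⟨p, q, hpq, hα⟩ := IsFractionRing.exists_reduced_fraction (A := D)
    (algebraMap D (FractionRing D) N.content / algebraMap D (FractionRing D) b)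
  have hq0 : algebraMap D (FractionRing D) q ≠ 0 := by simp
  refine ⟨N.primPart, p, q, N.isPrimitive_primPart, nonZeroDivisors.ne_zero q.2, hpq, ?_⟩
  rw [IsFractionRing.mk'_eq_div, div_eq_div_iff hq0 hb0] at hα
  apply mul_left_cancel₀ (C_ne_zero.mpr hb0)
  have h1 : C (algebraMap D (FractionRing D) b) * a =
      C (algebraMap D (FractionRing D) N.content) *
        N.primPart.map (algebraMap D (FractionRing D)) := by
    rw [← map_C, ← map_C, ← Polynomial.map_mul, ← N.eq_C_content_mul_primPart, hba, map_C,
      ← smul_eq_C_mul, algebraMap_smul]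
  rw [mul_left_comm, h1, ← mul_assoc, ← mul_assoc, ← C_mul, ← C_mul,
    mul_comm _ (algebraMap D _ N.content), ← hα, mul_comm (algebraMap D _ p)]

theorem Polynomial.eq_zero_of_span_eval_image_eq_bot {D : Type*} [CommRing D] [IsDomain D]
    {S : Set D} (hS : S.Infinite) {f : D[X]}
    (h : Ideal.span ((fun s => f.eval s) '' S) = Ideal.span {(0 : D)}) : f = 0 := by
  refine eq_zero_of_infinite_isRoot f (hS.mono fun s hs => ?_)
  have := Ideal.subset_span (Set.mem_image_of_mem (fun s => f.eval s) hs)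
  rw [h] at this
  simpa using this

theorem Polynomial.dvd_generator_iff {D : Type*} [CommRing D] {S : Set D} {f : D[X]} {d c : D}
    (h : Ideal.span ((fun s => f.eval s) '' S) = Ideal.span {d}) :
    c ∣ d ↔ ∀ s ∈ S, c ∣ f.eval s := by
  rw [← Ideal.span_singleton_le_span_singleton, ← h, Ideal.span_le]
  simp [Set.subset_def, Ideal.mem_span_singleton]

/-- The denominator of the leading fraction of an integer-valued polynomial divides every value
of its primitive part. -/
theorem IntS.dvd_eval_of_isRelPrime {D : Type*} [CommRing D] [IsDomain D]
    [IsPrincipalIdealRing D] {S : Set D} {a : (FractionRing D)[X]} (ha : a ∈ IntS D S)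
    {A : D[X]} {p q : D} (hpq : IsRelPrime p q)
    (e : C (algebraMap D (FractionRing D) q) * a =
        C (algebraMap D (FractionRing D) p) * A.map (algebraMap D (FractionRing D)))
    {s : D} (hs : s ∈ S) : q ∣ A.eval s := by
  obtain ⟨t, ht⟩ := ha s hs
  have h := congrArg (eval (algebraMap D (FractionRing D) s)) e
  rw [eval_mul, eval_mul, eval_C, eval_C, ← ht, eval_map_algebraMap, aeval_algebraMap_apply,
    ← map_mul, coe_aeval_eq_eval, ← map_mul] at h
  exact hpq.symm.dvd_of_dvd_mul_left ⟨t, (IsFractionRing.injective D (FractionRing D) h).symm⟩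

theorem IntS.natDegree_eq_zero_of_isUnit {D : Type*} [CommRing D] [IsDomain D] {S : Set D}
    {g : IntS D S} (hg : IsUnit g) : (g : (FractionRing D)[X]).natDegree = 0 :=
  Polynomial.natDegree_eq_zero_of_isUnit (hg.map (IntS D S).subtype)

/-- A polynomial divided by a nonzero fixed divisor is integer-valued. -/
theorem IntS.C_inv_mul_map_mem {D : Type*} [CommRing D] [IsDomain D] {S : Set D} {f : D[X]}
    {d : D} (hd0 : d ≠ 0) (hd : Ideal.span ((fun s => f.eval s) '' S) = Ideal.span {d}) :
    C ((algebraMap D (FractionRing D) d)⁻¹) * f.map (algebraMap D (FractionRing D)) ∈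
      IntS D S := by
  intro s hs
  obtain ⟨t, ht⟩ := (dvd_generator_iff hd).mp dvd_rfl s hs
  have hd0' : algebraMap D (FractionRing D) d ≠ 0 := by simpa using hd0
  refine ⟨t, ?_⟩
  rw [eval_mul, eval_C, eval_map_algebraMap, aeval_algebraMap_apply, coe_aeval_eq_eval, ht,
    map_mul, inv_mul_cancel_left₀ hd0']

theorem IntS.isUnit_of_mul_eq_of_natDegree_eq_zero {D : Type*} [CommRing D] [IsDomain D]
    {S : Set D} (hS : S.Nonempty) {f : D[X]} {d : D} (hd0 : d ≠ 0)
    (hd : Ideal.span ((fun s => f.eval s) '' S) = Ideal.span {d}) {a b : IntS D S}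
    (e : C (algebraMap D (FractionRing D) d) * ((a * b : IntS D S) : (FractionRing D)[X]) =
      f.map (algebraMap D (FractionRing D)))
    (ha : (a : (FractionRing D)[X]).natDegree = 0) : IsUnit a := by
  have inj := IsFractionRing.injective D (FractionRing D)
  obtain ⟨s₀, hs₀⟩ := hS
  obtain ⟨c, hc⟩ := a.2 s₀ hs₀
  have hac : (a : (FractionRing D)[X]) = C (algebraMap D (FractionRing D) c) := by
    rw [eq_C_of_natDegree_eq_zero ha] at hc ⊢
    rw [hc, eval_C]
  have hdc : d * c ∣ d := by
    rw [dvd_generator_iff hd]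
    intro s hs
    obtain ⟨t, ht⟩ := b.2 s hs
    refine ⟨t, inj ?_⟩
    have h := congrArg (eval (algebraMap D (FractionRing D) s)) e
    rw [Subring.coe_mul, hac, eval_mul, eval_mul, eval_C, eval_C, ← ht, eval_map_algebraMap,
      aeval_algebraMap_apply, coe_aeval_eq_eval] at h
    rw [← h, map_mul, map_mul, mul_assoc]
  obtain ⟨t, ht⟩ := hdc
  have hct : c * t = 1 := mul_left_cancel₀ hd0 (by rw [mul_one, ← mul_assoc, ← ht])
  refine IsUnit.of_mul_eq_one
    ⟨C (algebraMap D (FractionRing D) t), fun s _ => ⟨t, by rw [eval_C]⟩⟩ (Subtype.ext ?_)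
  rw [Subring.coe_mul, hac, ← C_mul, ← map_mul, hct, map_one, C_1, Subring.coe_one]

/-- **Theorem (Chapman–McClain).** Let `D` be a PID and `S ⊆ D` infinite. Let
`f ∈ D[x]` be nonconstant and primitive, and let `d` be a fixed divisor of `f`
over `S` (a generator of the ideal generated by the values of `f` on `S`). Then
`f/d` is irreducible in `Int(S,D)` if and only if either `f` is irreducible in
`D[x]`, or for every factorization `f = f₁ f₂` into nonconstant polynomials of
`D[x]` with fixed divisors `d₁, d₂` over `S`, `d` does not divide `d₁ · d₂`. -/
theorem irreducible_iff_chapman_mcclain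
    (D : Type*) [CommRing D] [IsDomain D] [IsPrincipalIdealRing D]
    (S : Set D) (hS : S.Infinite)
    (f : Polynomial D) (hfdeg : 0 < f.natDegree) (hfprim : f.IsPrimitive)
    (d : D) (hd : Ideal.span ((fun s => f.eval s) '' S) = Ideal.span {d}) :
    ∀ g : IntS D S,
      (g : Polynomial (FractionRing D))
        = C ((algebraMap D (FractionRing D) d)⁻¹) * f.map (algebraMap D (FractionRing D)) →
      (Irreducible g ↔
        (Irreducible f ∨
          ∀ f₁ f₂ : Polynomial D, f = f₁ * f₂ →
            0 < f₁.natDegree → 0 < f₂.natDegree →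
            ∀ d₁ d₂ : D,
              Ideal.span ((fun s => f₁.eval s) '' S) = Ideal.span {d₁} →
              Ideal.span ((fun s => f₂.eval s) '' S) = Ideal.span {d₂} →
              ¬ d ∣ d₁ * d₂)) := by
  intro g hg
  have inj := IsFractionRing.injective D (FractionRing D)
  have hd0 : d ≠ 0 := by
    rintro rfl
    rw [eq_zero_of_span_eval_image_eq_bot hS hd] at hfdeg
    simp at hfdeg
  have hd0' : algebraMap D (FractionRing D) d ≠ 0 := by simpa using hd0
  have hdg : C (algebraMap D (FractionRing D) d) * (g : (FractionRing D)[X]) =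
      f.map (algebraMap D (FractionRing D)) := by
    rw [hg, ← mul_assoc, ← C_mul, mul_inv_cancel₀ hd0', C_1, one_mul]
  have hgdeg : (g : (FractionRing D)[X]).natDegree ≠ 0 := by
    rw [hg, natDegree_C_mul (inv_ne_zero hd0'), natDegree_map_eq_of_injective inj]
    exact hfdeg.ne'
  constructor
  · intro hirr
    right
    rintro f₁ f₂ rfl h₁ h₂ d₁ d₂ hd₁ hd₂ ⟨c, hc⟩
    have ne_zero : ∀ {h : D[X]} {e : D}, 0 < h.natDegree →
        Ideal.span ((fun s => h.eval s) '' S) = Ideal.span {e} → e ≠ 0 := by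
      rintro h e hpos he rfl
      rw [eq_zero_of_span_eval_image_eq_bot hS he] at hpos
      simp at hpos
    have hd₁0 := ne_zero h₁ hd₁
    have hd₂0 := ne_zero h₂ hd₂
    have hd₁0' : algebraMap D (FractionRing D) d₁ ≠ 0 := by simpa using hd₁0
    have hd₂0' : algebraMap D (FractionRing D) d₂ ≠ 0 := by simpa using hd₂0
    have hc0 : c ≠ 0 := by
      rintro rfl
      exact mul_ne_zero hd₁0 hd₂0 (by rw [hc, mul_zero])
    have hc0' : algebraMap D (FractionRing D) c ≠ 0 := by simpa using hc0
    let g₁ : IntS D S := ⟨_, IntS.C_inv_mul_map_mem hd₁0 hd₁⟩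
    let g₂ : IntS D S := ⟨_, IntS.C_inv_mul_map_mem hd₂0 hd₂⟩
    let γ : IntS D S := ⟨C (algebraMap D (FractionRing D) c), fun s _ => ⟨c, by rw [eval_C]⟩⟩
    have hfac : g = (γ * g₁) * g₂ := by
      apply Subtype.ext
      have hK : (algebraMap D (FractionRing D) d)⁻¹ = algebraMap D (FractionRing D) c *
          (algebraMap D (FractionRing D) d₁)⁻¹ * (algebraMap D (FractionRing D) d₂)⁻¹ := by
        have := congrArg (algebraMap D (FractionRing D)) hc
        rw [map_mul, map_mul] at this
        field_simp
        rw [this]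
      rw [hg, hK, Subring.coe_mul, Subring.coe_mul, Polynomial.map_mul, C_mul, C_mul]
      simp only [γ, g₁, g₂]
      ring
    rcases hirr.isUnit_or_isUnit hfac with hu | hu
    · have := IntS.natDegree_eq_zero_of_isUnit hu
      rw [Subring.coe_mul, natDegree_C_mul hc0', natDegree_C_mul (inv_ne_zero hd₁0'),
        natDegree_map_eq_of_injective inj] at this
      exact h₁.ne' this
    · have := IntS.natDegree_eq_zero_of_isUnit hu
      rw [natDegree_C_mul (inv_ne_zero hd₂0'), natDegree_map_eq_of_injective inj] at this
      exact h₂.ne' this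
  · intro h
    replace h : ∀ f₁ f₂ : D[X], f = f₁ * f₂ → 0 < f₁.natDegree → 0 < f₂.natDegree →
        ∀ d₁ d₂ : D, Ideal.span ((fun s => f₁.eval s) '' S) = Ideal.span {d₁} →
          Ideal.span ((fun s => f₂.eval s) '' S) = Ideal.span {d₂} → ¬ d ∣ d₁ * d₂ := by
      rcases h with hirr | h
      · intro f₁ f₂ hf h₁ h₂
        rcases hirr.isUnit_or_isUnit hf with hu | hu
        · exact absurd (natDegree_eq_zero_of_isUnit hu) h₁.ne'
        · exact absurd (natDegree_eq_zero_of_isUnit hu) h₂.ne'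
      · exact h
    refine ⟨fun hu => hgdeg (IntS.natDegree_eq_zero_of_isUnit hu), ?_⟩
    rintro a b rfl
    by_cases ha : (a : (FractionRing D)[X]).natDegree = 0
    · exact .inl (IntS.isUnit_of_mul_eq_of_natDegree_eq_zero hS.nonempty hd0 hd hdg ha)
    by_cases hb : (b : (FractionRing D)[X]).natDegree = 0
    · rw [mul_comm a b] at hdg
      exact .inr (IntS.isUnit_of_mul_eq_of_natDegree_eq_zero hS.nonempty hd0 hd hdg hb)
    exfalso
    have ha0 : (a : (FractionRing D)[X]) ≠ 0 := fun h0 => ha (by rw [h0, natDegree_zero])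
    have hb0 : (b : (FractionRing D)[X]) ≠ 0 := fun h0 => hb (by rw [h0, natDegree_zero])
    obtain ⟨A, p, q, hA, hq, hpq, eA⟩ := exists_reduced_isPrimitive (a : (FractionRing D)[X])
    obtain ⟨B, p', q', hB, hq', hpq', eB⟩ := exists_reduced_isPrimitive (b : (FractionRing D)[X])
    have natDegree_eq : ∀ {x : (FractionRing D)[X]} {X : D[X]} {r t : D}, x ≠ 0 → t ≠ 0 →
        C (algebraMap D (FractionRing D) t) * x =
          C (algebraMap D (FractionRing D) r) * X.map (algebraMap D (FractionRing D)) →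
        X.natDegree = x.natDegree := by
      intro x X r t hx ht e
      have ht' : algebraMap D (FractionRing D) t ≠ 0 := by simpa using ht
      have hr' : algebraMap D (FractionRing D) r ≠ 0 := by
        intro hr
        rw [hr, C_0, zero_mul] at e
        exact mul_ne_zero (C_ne_zero.mpr ht') hx e
      have := congrArg natDegree e
      rw [natDegree_C_mul ht', natDegree_C_mul hr', natDegree_map_eq_of_injective inj] at this
      exact this.symm
    obtain ⟨inst⟩ : Nonempty (NormalizedGCDMonoid D) := inferInstance
    have key : C (q * q') * f = C (d * (p * p')) * (A * B) := by
      apply map_injective _ inj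
      simp only [Polynomial.map_mul, map_C, map_mul]
      rw [← hdg, Subring.coe_mul]
      linear_combination C (algebraMap D (FractionRing D) d) *
        (C (algebraMap D (FractionRing D) q') * (b : (FractionRing D)[X]) * eA +
          C (algebraMap D (FractionRing D) p) * A.map (algebraMap D (FractionRing D)) * eB)
    obtain ⟨u, hu, hf⟩ := hfprim.exists_unit_of_C_mul_eq (hA.mul hB) (mul_ne_zero hq hq') key
    have hdq : d ∣ q * q' := (Units.dvd_mul_right (u := u)).mp ⟨_, hu.symm⟩
    obtain ⟨d₁, hd₁⟩ := (IsPrincipalIdealRing.principal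
      (Ideal.span ((fun s => (C (u : D) * A).eval s) '' S))).principal
    obtain ⟨d₂, hd₂⟩ := (IsPrincipalIdealRing.principal
      (Ideal.span ((fun s => B.eval s) '' S))).principal
    refine h (C (u : D) * A) B (by rw [hf, mul_assoc]) ?_ ?_ d₁ d₂ hd₁ hd₂
      (hdq.trans (mul_dvd_mul ?_ ?_))
    · rw [natDegree_C_mul u.ne_zero, natDegree_eq ha0 hq eA]
      exact Nat.pos_of_ne_zero ha
    · rw [natDegree_eq hb0 hq' eB]
      exact Nat.pos_of_ne_zero hb
    · rw [dvd_generator_iff hd₁]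
      intro s hs
      rw [eval_mul]
      exact (IntS.dvd_eval_of_isRelPrime a.2 hpq eA hs).mul_left _
    · rw [dvd_generator_iff hd₂]
      exact fun s hs => IntS.dvd_eval_of_isRelPrime b.2 hpq' eB hs
end

section
/- Let D be a principal ideal domain, p a prime element of D, and M = (p) the prime ideal it generates, regarded as a subset of D. Let f ∈ D[x] be a nonconstant polynomial that is irreducible as an element of Int(D). Then f is irreducible as an element of Int(M,D) if and only if f is image-primitive on M, i.e., the ideal of D generated by {f(m) : m ∈ M} equals D. -/
open Polynomial

theorem IntS.map_mem_s11 {D : Type*} [CommRing D] [IsDomain D] (S : Set D) (g : D[X]) :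
    g.map (algebraMap D (FractionRing D)) ∈ IntS D S :=
  fun s _ => ⟨g.eval s, by rw [eval_map_algebraMap, aeval_algebraMap_apply_eq_algebraMap_eval]⟩

/-- An integer-valued polynomial on a set containing `0` is a unit if and only if it is a
constant given by a unit of `D`. -/
theorem IntS.isUnit_iff {D : Type*} [CommRing D] [IsDomain D] {S : Set D} (hS : (0 : D) ∈ S)
    (g : IntS D S) :
    IsUnit g ↔ ∃ c : D, IsUnit c ∧
      (g : (FractionRing D)[X]) = C (algebraMap D (FractionRing D) c) := by
  constructor
  · intro hg
    obtain ⟨v, hv⟩ := hg.exists_right_inv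
    have hgv : (g : (FractionRing D)[X]) * v = 1 := congrArg Subtype.val hv
    obtain ⟨k, -, hk⟩ := Polynomial.isUnit_iff.mp (IsUnit.of_mul_eq_one _ hgv)
    obtain ⟨c, hc⟩ := g.2 0 hS
    obtain ⟨d, hd⟩ := v.2 0 hS
    have hkc : algebraMap D (FractionRing D) c = k := by rw [hc, ← hk, eval_C]
    refine ⟨c, IsUnit.of_mul_eq_one d ?_, by rw [← hk, hkc]⟩
    apply FaithfulSMul.algebraMap_injective D (FractionRing D)
    rw [map_mul, map_one, hc, hd, ← eval_mul, hgv, eval_one]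
  · rintro ⟨c, hc, hg⟩
    obtain ⟨d, hd⟩ := hc.exists_right_inv
    refine IsUnit.of_mul_eq_one ⟨_, IntS.map_mem_s11 S (C d)⟩ (Subtype.ext ?_)
    change (g : (FractionRing D)[X]) * (C d).map (algebraMap D (FractionRing D)) = 1
    rw [hg, map_C, ← C_mul, ← map_mul, hd, map_one, C_1]

/-- A polynomial over `D` that is irreducible in a ring of integer-valued polynomials and
is not a unit of `D[X]` is irreducible in `D[X]`. -/
theorem IntS.irreducible_of_irreducible {D : Type*} [CommRing D] [IsDomain D] {S : Set D}
    (hS : (0 : D) ∈ S) {f : D[X]} (hf : ¬ IsUnit f) {F : IntS D S}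
    (hF : (F : (FractionRing D)[X]) = f.map (algebraMap D (FractionRing D)))
    (hirr : Irreducible F) : Irreducible f := by
  have key : ∀ a : D[X], IsUnit (⟨_, IntS.map_mem_s11 S a⟩ : IntS D S) → IsUnit a := by
    intro a ha
    obtain ⟨c, hc, h⟩ := (IntS.isUnit_iff hS _).mp ha
    have hac : a = C c := by
      apply map_injective _ (FaithfulSMul.algebraMap_injective D (FractionRing D))
      rw [map_C]
      exact h
    rw [hac]
    exact Polynomial.isUnit_C.mpr hc
  refine ⟨hf, fun a b hab => ?_⟩
  have hmul : F = (⟨_, IntS.map_mem_s11 S a⟩ : IntS D S) * ⟨_, IntS.map_mem_s11 S b⟩ := by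
    apply Subtype.ext
    rw [hF, hab, Polynomial.map_mul]
    rfl
  exact (hirr.isUnit_or_isUnit hmul).imp (key a) (key b)

/-- If an image-primitive polynomial is written as a product of integer-valued polynomials
one of which is constant, then that factor is a unit. -/
theorem IntS.isUnit_of_natDegree_eq_zero_s11 {D : Type*} [CommRing D] [IsDomain D] {S : Set D}
    (hS : (0 : D) ∈ S) {f : D[X]}
    (hprim : Ideal.span ((fun a => f.eval a) '' S) = (⊤ : Ideal D)) (g h : IntS D S)
    (hgh : f.map (algebraMap D (FractionRing D)) = (g : (FractionRing D)[X]) * h)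
    (hg : (g : (FractionRing D)[X]).natDegree = 0) : IsUnit g := by
  obtain ⟨k, hk⟩ := natDegree_eq_zero.mp hg
  obtain ⟨c, hc⟩ := g.2 0 hS
  rw [← hk, eval_C] at hc
  refine (IntS.isUnit_iff hS g).mpr ⟨c, ?_, by rw [hc, hk]⟩
  rw [← Ideal.span_singleton_eq_top, eq_top_iff, ← hprim, Ideal.span_le]
  rintro _ ⟨s, hs, rfl⟩
  obtain ⟨d, hd⟩ := h.2 s hs
  refine Ideal.mem_span_singleton.mpr ⟨d, ?_⟩
  apply FaithfulSMul.algebraMap_injective D (FractionRing D)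
  rw [map_mul, hc, hd, ← aeval_algebraMap_apply_eq_algebraMap_eval, ← eval_map_algebraMap, hgh,
    eval_mul, ← hk, eval_C]

/-- A polynomial vanishing on a nonzero principal ideal of an infinite domain is zero. -/
theorem Polynomial.eq_zero_of_forall_eval_mem_span_singleton {D : Type*} [CommRing D] [IsDomain D]
    [Infinite D] {p : D} (hp : p ≠ 0) {f : D[X]}
    (hf : ∀ m ∈ Ideal.span {p}, f.eval m = 0) : f = 0 := by
  have hinj : Function.Injective (fun a : D => p * a) := mul_right_injective₀ hp
  refine eq_zero_of_infinite_isRoot f ((Set.infinite_range_of_injective hinj).mono ?_)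
  rintro _ ⟨a, rfl⟩
  exact hf _ (Ideal.mem_span_singleton.mpr ⟨a, rfl⟩)

/-- **Remark.** Let `D` be a PID, `p` a prime element, `M = (p)`. If `f ∈ D[x]` is
nonconstant and irreducible as an element of `Int(D)`, then `f` is irreducible as
an element of `Int(M,D)` if and only if `f` is image-primitive on `M`, i.e. the
ideal of `D` generated by the values `f(m)`, `m ∈ M`, equals `D`. -/
theorem irreducible_in_IntM_iff_image_primitive
    (D : Type*) [CommRing D] [IsDomain D] [IsPrincipalIdealRing D]
    (p : D) (hp : Prime p)
    (f : Polynomial D) (hdeg : 0 < f.natDegree)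
    (fD : IntS D (Set.univ : Set D))
    (hfD : (fD : Polynomial (FractionRing D)) = f.map (algebraMap D (FractionRing D)))
    (hirrD : Irreducible fD) :
    ∀ fM : IntS D ((Ideal.span {p} : Ideal D) : Set D),
      (fM : Polynomial (FractionRing D)) = f.map (algebraMap D (FractionRing D)) →
      (Irreducible fM ↔
        Ideal.span ((fun a => f.eval a) '' ((Ideal.span {p} : Ideal D) : Set D))
          = (⊤ : Ideal D)) := by
  intro fM hfM
  have hinj := FaithfulSMul.algebraMap_injective D (FractionRing D)
  have h0 : (0 : D) ∈ ((Ideal.span {p} : Ideal D) : Set D) := zero_mem _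
  have hdegK : (f.map (algebraMap D (FractionRing D))).natDegree = f.natDegree :=
    natDegree_map_eq_of_injective hinj f
  constructor
  · intro hirrM
    obtain ⟨d, hd⟩ := IsPrincipalIdealRing.principal
      (Ideal.span ((fun a => f.eval a) '' ((Ideal.span {p} : Ideal D) : Set D)))
    replace hd : Ideal.span ((fun a => f.eval a) '' ((Ideal.span {p} : Ideal D) : Set D))
      = Ideal.span {d} := hd
    have hdvd : ∀ m ∈ Ideal.span {p}, d ∣ f.eval m := fun m hm => by
      rw [← Ideal.mem_span_singleton, ← hd]
      exact Ideal.subset_span ⟨m, hm, rfl⟩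
    have : Infinite D := by
      by_contra hfin
      have : Finite D := not_infinite_iff_finite.mp hfin
      have := Finite.isField_of_domain D
      obtain ⟨q, hq⟩ := this.mul_inv_cancel hp.ne_zero
      exact hp.not_isUnit (IsUnit.of_mul_eq_one q hq)
    have hd0 : d ≠ 0 := by
      rintro rfl
      have hf0 := Polynomial.eq_zero_of_forall_eval_mem_span_singleton hp.ne_zero
        fun m hm => zero_dvd_iff.mp (hdvd m hm)
      simp [hf0] at hdeg
    have hdK : algebraMap D (FractionRing D) d ≠ 0 := fun h => hd0 (hinj (by rw [h, map_zero]))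
    let g : IntS D ((Ideal.span {p} : Ideal D) : Set D) :=
      ⟨C (algebraMap D (FractionRing D) d)⁻¹ * f.map (algebraMap D (FractionRing D)), by
        intro m hm
        obtain ⟨e, he⟩ := hdvd m hm
        refine ⟨e, ?_⟩
        rw [eval_mul, eval_C, eval_map_algebraMap, aeval_algebraMap_apply_eq_algebraMap_eval, he,
          map_mul, inv_mul_cancel_left₀ hdK]⟩
    let c : IntS D ((Ideal.span {p} : Ideal D) : Set D) := ⟨_, IntS.map_mem_s11 _ (C d)⟩
    have hmul : fM = c * g := by
      apply Subtype.ext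
      change (fM : (FractionRing D)[X]) = (C d).map (algebraMap D (FractionRing D)) *
        (C (algebraMap D (FractionRing D) d)⁻¹ * f.map (algebraMap D (FractionRing D)))
      rw [hfM, map_C, ← mul_assoc, ← C_mul, mul_inv_cancel₀ hdK, C_1, one_mul]
    rw [hd, Ideal.span_singleton_eq_top]
    rcases hirrM.isUnit_or_isUnit hmul with h | h
    · obtain ⟨u, hu, hcu⟩ := (IntS.isUnit_iff h0 _).mp h
      replace hcu : (C d).map (algebraMap D (FractionRing D)) =
        C (algebraMap D (FractionRing D) u) := hcu
      rw [map_C] at hcu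
      rwa [hinj (C_injective hcu)]
    · obtain ⟨u, -, hgu⟩ := (IntS.isUnit_iff h0 _).mp h
      replace hgu : C (algebraMap D (FractionRing D) d)⁻¹ * f.map (algebraMap D (FractionRing D)) =
        C (algebraMap D (FractionRing D) u) := hgu
      have := congrArg natDegree hgu
      rw [natDegree_C_mul (inv_ne_zero hdK), hdegK, natDegree_C] at this
      omega
  · intro hprim
    have hirr : Irreducible f := IntS.irreducible_of_irreducible (Set.mem_univ 0)
      (not_isUnit_of_natDegree_pos f hdeg) hfD hirrD
    have hirrK : Irreducible (f.map (algebraMap D (FractionRing D))) :=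
      (hirr.isPrimitive hdeg.ne').irreducible_iff_irreducible_map_fraction_map.mp hirr
    refine ⟨fun hu => ?_, fun a b hab => ?_⟩
    · obtain ⟨u, -, h⟩ := (IntS.isUnit_iff h0 _).mp hu
      rw [hfM] at h
      rw [← hdegK, h, natDegree_C] at hdeg
      exact hdeg.false
    · have hfab : f.map (algebraMap D (FractionRing D)) = (a : (FractionRing D)[X]) * b := by
        rw [← hfM, hab]
        rfl
      exact (hirrK.isUnit_or_isUnit hfab).imp
        (fun h => IntS.isUnit_of_natDegree_eq_zero_s11 h0 hprim a b hfab (natDegree_eq_zero_of_isUnit h))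
        (fun h => IntS.isUnit_of_natDegree_eq_zero_s11 h0 hprim b a (by rw [hfab, mul_comm])
          (natDegree_eq_zero_of_isUnit h))
end

section
/- Let D be a principal ideal domain with quotient field K, let p and q be non-associate prime elements of D, let M = (p), and let n ≥ 1. Then the polynomial f = (x^n + Σ_{i=0}^{n-1} p·x^i)/p ∈ K[x] satisfies: f ∈ Int(M,D); f ∉ Int(D); and f ∉ Int((q),D). In particular, Int(D) is strictly contained in Int(M,D), and Int(M,D) ≠ Int((q),D). -/
open Polynomial

/-- For a prime `p`, the value of `(x ^ n + ∑ i < n, p x ^ i) / p` at `s` lies in `D` exactly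
when `p ∣ s`. -/
lemma eval_mem_range_iff_dvd {D : Type*} [CommRing D] [IsDomain D] {p : D} (hp : Prime p)
    {n : ℕ} (hn : n ≠ 0) (s : D) :
    (C ((algebraMap D (FractionRing D) p)⁻¹) *
        (X ^ n + ∑ i ∈ Finset.range n, C (algebraMap D (FractionRing D) p) * X ^ i)).eval
        (algebraMap D (FractionRing D) s) ∈ (algebraMap D (FractionRing D)).range ↔ p ∣ s := by
  have hinj := IsFractionRing.injective D (FractionRing D)
  have hp0 : algebraMap D (FractionRing D) p ≠ 0 :=
    (map_ne_zero_iff _ hinj).mpr hp.ne_zero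
  have heval : (C ((algebraMap D (FractionRing D) p)⁻¹) *
        (X ^ n + ∑ i ∈ Finset.range n, C (algebraMap D (FractionRing D) p) * X ^ i)).eval
        (algebraMap D (FractionRing D) s) = (algebraMap D (FractionRing D) p)⁻¹ *
        algebraMap D (FractionRing D) (s ^ n + p * ∑ i ∈ Finset.range n, s ^ i) := by
    simp [eval_finsetSum, Finset.mul_sum]
  rw [heval, ← hp.dvd_pow_iff_dvd hn, ← dvd_add_left (dvd_mul_right p _)]
  constructor
  · rintro ⟨d, hd⟩
    refine ⟨d, hinj ?_⟩
    rw [map_mul, hd, mul_inv_cancel_left₀ hp0]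
  · rintro ⟨d, hd⟩
    exact ⟨d, by rw [hd, map_mul, inv_mul_cancel_left₀ hp0]⟩

/-- **Example.** Let `D` be a PID, `p, q` non-associate prime elements, `M = (p)`,
and `n ≥ 1`. The polynomial `f = (x^n + Σ_{i<n} p x^i)/p` lies in `Int(M,D)` but
neither in `Int(D)` nor in `Int((q),D)`. In particular `Int(D) ⊊ Int(M,D)` and
`Int(M,D) ≠ Int((q),D)`. -/
theorem IntM_strictly_larger_and_distinct
    (D : Type*) [CommRing D] [IsDomain D] [IsPrincipalIdealRing D]
    (p q : D) (hp : Prime p) (hq : Prime q) (hpq : ¬ Associated p q)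
    (n : ℕ) (hn : 1 ≤ n) :
    (C ((algebraMap D (FractionRing D) p)⁻¹) *
        (X ^ n + ∑ i ∈ Finset.range n, C (algebraMap D (FractionRing D) p) * X ^ i)
      ∈ IntS D ((Ideal.span {p} : Ideal D) : Set D)) ∧
    (C ((algebraMap D (FractionRing D) p)⁻¹) *
        (X ^ n + ∑ i ∈ Finset.range n, C (algebraMap D (FractionRing D) p) * X ^ i)
      ∉ IntS D (Set.univ : Set D)) ∧
    (C ((algebraMap D (FractionRing D) p)⁻¹) *
        (X ^ n + ∑ i ∈ Finset.range n, C (algebraMap D (FractionRing D) p) * X ^ i)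
      ∉ IntS D ((Ideal.span {q} : Ideal D) : Set D)) ∧
    IntS D (Set.univ : Set D) < IntS D ((Ideal.span {p} : Ideal D) : Set D) ∧
    IntS D ((Ideal.span {p} : Ideal D) : Set D)
      ≠ IntS D ((Ideal.span {q} : Ideal D) : Set D) := by
  have key := eval_mem_range_iff_dvd hp (Nat.one_le_iff_ne_zero.mp hn)
  have hM : C ((algebraMap D (FractionRing D) p)⁻¹) *
        (X ^ n + ∑ i ∈ Finset.range n, C (algebraMap D (FractionRing D) p) * X ^ i)
      ∈ IntS D ((Ideal.span {p} : Ideal D) : Set D) :=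
    fun s hs => (key s).mpr (Ideal.mem_span_singleton.mp hs)
  have hD : C ((algebraMap D (FractionRing D) p)⁻¹) *
        (X ^ n + ∑ i ∈ Finset.range n, C (algebraMap D (FractionRing D) p) * X ^ i)
      ∉ IntS D (Set.univ : Set D) :=
    fun h => hp.not_dvd_one ((key 1).mp (h 1 (Set.mem_univ 1)))
  have hN : C ((algebraMap D (FractionRing D) p)⁻¹) *
        (X ^ n + ∑ i ∈ Finset.range n, C (algebraMap D (FractionRing D) p) * X ^ i)
      ∉ IntS D ((Ideal.span {q} : Ideal D) : Set D) :=
    fun h => hpq (hp.associated_of_dvd hq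
      ((key q).mp (h q (Ideal.mem_span_singleton_self q))))
  refine ⟨hM, hD, hN, SetLike.lt_iff_le_and_exists.mpr ⟨?_, _, hM, hD⟩, fun h => hN (h ▸ hM)⟩
  exact fun f hf s _ => hf s (Set.mem_univ s)
end
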